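/- arXiv:2303.01969 — 3 statements merged into one kernel-verified Lean document; each statement's English description precedes it below -/
import Mathlib

section
/- There is no regular map from the hyperbolic plane ℍ² to T₃ × Z, where T₃ is the 3-regular tree and Z is the vertex set of a connected simple graph of uniformly bounded degree of polynomial growth (i.e. there exist C ≥ 1 and d such that every ball of radius r in Z contains at most C·r^d + C vertices), with the ℓ¹ product metric on T₃ × Z. -/
open Metric Set

/-- A metric space is 1-uniformly discrete. -/
def UnifDiscrete (X : Type*) [MetricSpace X] : Prop :=
  ∀ x y : X, x ≠ y → 1 ≤ dist x y

/-- Bounded geometry: balls of each radius have uniformly bounded cardinality. -/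
def BddGeom (X : Type*) [MetricSpace X] : Prop :=
  ∀ R : ℝ, ∃ N : ℕ, ∀ (x : X) (s : Finset X), ↑s ⊆ Metric.closedBall x R → s.card ≤ N

/-- A regular map between metric spaces. -/
def IsRegularMap {X Y : Type*} [MetricSpace X] [MetricSpace Y] (f : X → Y) : Prop :=
  ∃ κ : ℕ, 1 ≤ κ ∧ (∀ x x' : X, dist (f x) (f x') ≤ κ * (1 + dist x x')) ∧
    ∀ y : Y, ∃ c : Finset X, c.card ≤ κ ∧ f ⁻¹' Metric.ball y 1 ⊆ ⋃ x ∈ c, Metric.ball x 1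

/-- A quasi-isometric embedding. -/
def IsQIEmbedding {X Y : Type*} [MetricSpace X] [MetricSpace Y] (f : X → Y) : Prop :=
  ∃ L D : ℝ, 1 ≤ L ∧ 0 ≤ D ∧ ∀ x x' : X,
    L⁻¹ * dist x x' - D ≤ dist (f x) (f x') ∧ dist (f x) (f x') ≤ L * dist x x' + D

/-- A coarse Lipschitz map. -/
def CoarseLipschitz {X Y : Type*} [MetricSpace X] [MetricSpace Y] (f : X → Y) : Prop :=
  ∃ K : ℝ, 1 ≤ K ∧ ∀ x x' : X, dist (f x) (f x') ≤ K * dist x x' + K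

/-- The metric of `T` is the graph metric of a 3-regular tree. -/
def IsCubicTreeMetric (T : Type*) [MetricSpace T] : Prop :=
  ∃ G : SimpleGraph T, G.Connected ∧ G.IsAcyclic ∧
    (∀ v : T, (G.neighborSet v).ncard = 3) ∧
    ∀ u v : T, dist u v = (G.dist u v : ℝ)

/-- The metric of `Z` is the graph metric of a connected graph of uniformly bounded degree. -/
def IsBddDegGraphMetric (Z : Type*) [MetricSpace Z] : Prop :=
  ∃ G : SimpleGraph Z, G.Connected ∧
    (∃ D : ℕ, ∀ v : Z, (G.neighborSet v).ncard ≤ D) ∧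
    ∀ u v : Z, dist u v = (G.dist u v : ℝ)

/-- A non-decreasing subexponential function `[0,∞) → [0,∞)`. -/
def SubexpFun (g : ℝ → ℝ) : Prop :=
  MonotoneOn g (Set.Ici 0) ∧ (∀ r : ℝ, 0 ≤ g r) ∧
    Filter.Tendsto (fun r => Real.log (g r) / r) Filter.atTop (nhds 0)

/-- Every ball of radius `r` in `Z` contains at most `g r` points. -/
def HasGrowthBound (Z : Type*) [MetricSpace Z] (g : ℝ → ℝ) : Prop :=
  ∀ (z : Z) (r : ℝ), 0 ≤ r → ∀ s : Finset Z, ↑s ⊆ Metric.closedBall z r → (s.card : ℝ) ≤ g r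

def HasSubexpGrowth (Z : Type*) [MetricSpace Z] : Prop :=
  ∃ g : ℝ → ℝ, SubexpFun g ∧ HasGrowthBound Z g

def HasPolyGrowth (Z : Type*) [MetricSpace Z] : Prop :=
  ∃ (C : ℝ) (d : ℕ), 1 ≤ C ∧ HasGrowthBound Z (fun r => C * r ^ d + C)

/-- Distinct members of the family are at distance at least `r` from each other. -/
def SepFamily {X : Type*} [MetricSpace X] (r : ℝ) (𝒰 : Set (Set X)) : Prop :=
  ∀ U ∈ 𝒰, ∀ V ∈ 𝒰, U ≠ V → ∀ x ∈ U, ∀ y ∈ V, r ≤ dist x y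

/-- A decomposition of `X` into `n+1` colours of `r`-separated pieces. -/
def Decomp {X : Type*} [MetricSpace X] (n : ℕ) (r : ℝ) (𝒰 : Fin (n+1) → Set (Set X)) : Prop :=
  (∀ x : X, ∃ i, ∃ U ∈ 𝒰 i, x ∈ U) ∧ ∀ i, SepFamily r (𝒰 i)

/-- A collection of subsets of `X` has growth uniformly controlled by the family `F`. -/
def FGrowing {X : Type*} [MetricSpace X] (F : Set (ℝ → ℝ)) (𝒰 : Set (Set X)) : Prop :=
  ∃ f ∈ F, ∃ C : ℝ, 1 ≤ C ∧ ∀ U ∈ 𝒰, ∀ (x : X) (r : ℝ), 0 ≤ r →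
    ∀ s : Finset X, ↑s ⊆ U ∩ Metric.closedBall x r → (s.card : ℝ) ≤ C * f (C * r) + C

/-- `asdim_F X ≤ n`. -/
def AsdimLE (F : Set (ℝ → ℝ)) (X : Type*) [MetricSpace X] (n : ℕ) : Prop :=
  ∀ r : ℝ, 0 < r → ∃ 𝒰 : Fin (n+1) → Set (Set X),
    Decomp n r 𝒰 ∧ FGrowing F (⋃ i, 𝒰 i)

/-- Iterated neighbourhoods `N^m_s(Y)` of `Y` with respect to the collection `𝒴`. -/
def iterNbhd {X : Type*} [MetricSpace X] (𝒴 : Set (Set X)) (s : ℝ) : ℕ → Set X → Set X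
  | 0, Y => Y
  | m + 1, Y => ⋃₀ {Y' | Y' ∈ 𝒴 ∧ ∃ x ∈ Y', ∃ z ∈ iterNbhd 𝒴 s m Y, dist x z ≤ s}

/-- `ov-asdim_F X ≤ n`. -/
def OvAsdimLE (F : Set (ℝ → ℝ)) (X : Type*) [MetricSpace X] (n : ℕ) : Prop :=
  ∀ r : ℝ, 0 < r → ∃ 𝒰 : Fin (n+1) → Set (Set X),
    Decomp n r 𝒰 ∧ ∀ s : ℝ, 1 ≤ s → ∀ m : ℕ,
      FGrowing F ((iterNbhd (⋃ i, 𝒰 i) s m) '' (⋃ i, 𝒰 i))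

/-- A family of non-decreasing functions `[0,∞) → [0,∞)`. -/
def NondecrFamily (F : Set (ℝ → ℝ)) : Prop :=
  ∀ f ∈ F, MonotoneOn f (Set.Ici 0) ∧ ∀ r : ℝ, 0 ≤ r → 0 ≤ f r

/-- The family of non-decreasing subexponential functions. -/
def seFamily : Set (ℝ → ℝ) := {g | SubexpFun g}

/-- The family of non-decreasing functions bounded by `C·r^d + C`. -/
def polyFamily (d : ℕ) : Set (ℝ → ℝ) :=
  {f | MonotoneOn f (Set.Ici 0) ∧ (∀ r : ℝ, 0 ≤ f r) ∧
    ∃ C : ℝ, 0 < C ∧ ∀ r : ℝ, 0 ≤ r → f r ≤ C * r ^ d + C}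

/-- `asdim X ≤ n` : classical asymptotic dimension. -/
def ClassicalAsdimLE (X : Type*) [MetricSpace X] (n : ℕ) : Prop :=
  ∀ r : ℝ, 0 < r → ∃ 𝒰 : Fin (n+1) → Set (Set X), Decomp n r 𝒰 ∧
    ∃ B : ℝ, ∀ U ∈ ⋃ i, 𝒰 i, ∀ x ∈ U, ∀ y ∈ U, dist x y ≤ B

theorem SimpleGraph.IsTree.exists_ancestor {T : Type*} {G : SimpleGraph T} (hG : G.IsTree)
    (t : T) : ∃ anc : ℕ → T → T,
      (∀ k w, k ≤ G.dist t w → G.dist (anc k w) w + k ≤ G.dist t w) ∧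
      ∀ k w w', G.Adj w w' → k ≤ G.dist t w → k ≤ G.dist t w' → anc k w = anc k w' := by
  choose p hp hlen using fun w => hG.connected.exists_path_of_dist t w
  refine ⟨fun k w => (p w).getVert k, fun k w hk => ?_, ?_⟩
  · have h := G.dist_le ((p w).drop k)
    rw [SimpleGraph.Walk.drop_length, hlen] at h
    dsimp only
    omega
  · have step : ∀ k w w', G.Adj w w' → G.dist t w' = G.dist t w + 1 → k ≤ G.dist t w →
        (p w).getVert k = (p w').getVert k := by
      intro k w w' hadj hd hk
      have hq : ((p w).concat hadj).IsPath := by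
        apply SimpleGraph.Walk.isPath_of_length_eq_dist
        rw [SimpleGraph.Walk.length_concat, hlen, hd]
      have h : (p w).concat hadj = p w' :=
        congrArg Subtype.val
          ((hG.isAcyclic.subsingleton_path t w').elim ⟨_, hq⟩ ⟨_, hp w'⟩)
      rw [← h, SimpleGraph.Walk.concat_eq_append, SimpleGraph.Walk.getVert_append, hlen]
      rcases hk.lt_or_eq with hk | hk
      · rw [if_pos hk]
      · rw [if_neg hk.not_lt, hk, Nat.sub_self, SimpleGraph.Walk.getVert_zero, ← hlen,
          SimpleGraph.Walk.getVert_length]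
    intro k w w' hadj hk hk'
    rcases hG.dist_eq_dist_add_one_of_adj t hadj with h | h
    · exact (step k w' w hadj.symm h hk').symm
    · exact step k w w' hadj h hk

theorem SimpleGraph.Connected.exists_adj_dist_eq {T : Type*} {G : SimpleGraph T}
    (hG : G.Connected) {w w' : T} {n : ℕ} (h : G.dist w w' = n + 1) :
    ∃ u, G.Adj w u ∧ G.dist u w' ≤ n := by
  obtain ⟨p, hp⟩ := hG.exists_walk_length_eq_dist w w'
  cases p with
  | nil => simp at h
  | cons hadj q =>
    refine ⟨_, hadj, (G.dist_le q).trans ?_⟩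
    rw [SimpleGraph.Walk.length_cons] at hp
    omega

/-- Far from the root `t` of a tree, points that are close to each other have a common ancestor. -/
theorem SimpleGraph.IsTree.exists_coarse_ancestor {T : Type*} {G : SimpleGraph T}
    (hG : G.IsTree) (t : T) : ∃ anc : ℕ → T → T,
      (∀ k w, k ≤ G.dist t w → G.dist (anc k w) w + k ≤ G.dist t w) ∧
      ∀ k n w w', G.dist w w' ≤ n → k + n ≤ G.dist t w → anc k w = anc k w' := by
  obtain ⟨anc, h₁, h₂⟩ := hG.exists_ancestor t
  refine ⟨anc, h₁, fun k n => ?_⟩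
  induction n with
  | zero =>
    intro w w' h _
    rw [hG.connected.dist_eq_zero_iff.mp (Nat.le_zero.mp h)]
  | succ n ih =>
    intro w w' h hk
    rcases h.lt_or_eq with h | h
    · exact ih w w' (by omega) (by omega)
    · obtain ⟨u, hu, hd⟩ := hG.connected.exists_adj_dist_eq h
      have hdu : G.dist t w ≤ G.dist t u + 1 := by
        have := hG.connected.dist_triangle (u := t) (v := u) (w := w)
        rwa [SimpleGraph.dist_eq_one_iff_adj.mpr hu.symm] at this
      rw [h₂ k w u hu (by omega) (by omega)]
      exact ih u w' hd (by omega)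

theorem SimpleGraph.Connected.exists_card_ball_le {T : Type*} {G : SimpleGraph T}
    (hG : G.Connected) (h3 : ∀ v, (G.neighborSet v).ncard = 3) (v : T) (ρ : ℕ) :
    ∃ B : Finset T, B.card ≤ 4 ^ ρ ∧ ∀ w, G.dist v w ≤ ρ → w ∈ B := by
  classical
  induction ρ with
  | zero =>
    refine ⟨{v}, by simp, fun w hw => ?_⟩
    rw [hG.dist_eq_zero_iff.mp (Nat.le_zero.mp hw)]
    exact Finset.mem_singleton_self w
  | succ ρ ih =>
    obtain ⟨B, hB, hmem⟩ := ih
    have hfin : ∀ u, (G.neighborSet u).Finite := fun u =>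
      Set.finite_of_ncard_ne_zero (by rw [h3]; norm_num)
    refine ⟨B.biUnion fun u => insert u (hfin u).toFinset, ?_, fun w hw => ?_⟩
    · refine (Finset.card_biUnion_le_card_mul B _ 4 fun u _ => ?_).trans ?_
      · refine (Finset.card_insert_le _ _).trans ?_
        rw [← Set.ncard_eq_toFinset_card _ (hfin u), h3]
      · rw [pow_succ]
        exact Nat.mul_le_mul_right 4 hB
    · rw [Finset.mem_biUnion]
      rcases hw.lt_or_eq with h | h
      · exact ⟨w, hmem w (by omega), Finset.mem_insert_self _ _⟩
      · rw [SimpleGraph.dist_comm] at h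
        obtain ⟨u, hu, hd⟩ := hG.exists_adj_dist_eq h
        rw [SimpleGraph.dist_comm] at hd
        exact ⟨u, hmem u hd, Finset.mem_insert_of_mem (by simpa using hu.symm)⟩


/-- The pair `(n, a)` stands for the `8`-adic interval `[a / 8 ^ n, (a + 1) / 8 ^ n)`;
`IsSubinterval I J` says that `J` is contained in `I`. -/
def IsSubinterval (I J : ℕ × ℕ) : Prop :=
  I.1 ≤ J.1 ∧ J.2 / 8 ^ (J.1 - I.1) = I.2

namespace IsSubinterval

theorem refl (I : ℕ × ℕ) : IsSubinterval I I := ⟨le_rfl, by simp⟩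

theorem trans {I J K : ℕ × ℕ} (h : IsSubinterval I J) (h' : IsSubinterval J K) :
    IsSubinterval I K := by
  refine ⟨h.1.trans h'.1, ?_⟩
  rw [← h.2, ← h'.2, Nat.div_div_eq_div_mul, ← pow_add]
  congr 2
  have := h.1
  have := h'.1
  omega

theorem of_le {I J L : ℕ × ℕ} (hI : IsSubinterval I L) (hJ : IsSubinterval J L)
    (h : I.1 ≤ J.1) : IsSubinterval I J := by
  refine ⟨h, ?_⟩
  rw [← hJ.2, ← hI.2, Nat.div_div_eq_div_mul, ← pow_add]
  congr 2
  have := hJ.1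
  omega

theorem eq_of_fst_eq {I J : ℕ × ℕ} (h : IsSubinterval I J) (hl : I.1 = J.1) : I = J := by
  obtain ⟨_, h⟩ := h
  refine Prod.ext hl ?_
  rw [← h, hl]
  simp

theorem child (n a : ℕ) (i : ℕ) (hi : i < 8) : IsSubinterval (n, a) (n + 1, 8 * a + i) := by
  refine ⟨Nat.le_succ n, ?_⟩
  simp only [Nat.add_sub_cancel_left, pow_one]
  omega

/-- Some child of `I` does not contain `J`. -/
theorem exists_child (I J : ℕ × ℕ) :
    ∃ F, F.1 = I.1 + 1 ∧ IsSubinterval I F ∧ F.2 / 8 = I.2 ∧ ¬ IsSubinterval F J := by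
  obtain ⟨n, a⟩ := I
  by_cases h : IsSubinterval (n + 1, 8 * a + 0) J
  · refine ⟨(n + 1, 8 * a + 1), rfl, child n a 1 (by norm_num), by dsimp only; omega, fun h' => ?_⟩
    have := (h.of_le h' le_rfl).eq_of_fst_eq rfl
    simp at this
  · exact ⟨_, rfl, child n a 0 (by norm_num), by dsimp only; omega, h⟩

end IsSubinterval

/-- Intervals are disjoint when they have no common subinterval. -/
def IntervalDisjoint (I J : ℕ × ℕ) : Prop :=
  ∀ L, IsSubinterval I L → ¬ IsSubinterval J L

/-- Among `k * k` intervals of distinct sizes, there are either `k` pairwise disjoint ones, or `k`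
nested ones; in the latter case we take children that avoid the smallest interval. -/
theorem exists_disjoint_subintervals (n k : ℕ) (J : ℕ → ℕ × ℕ) (hJ : ∀ j, (J j).1 = n + j) :
    ∃ (s : Finset ℕ) (F : ℕ → ℕ × ℕ), s.card = k ∧ (∀ j ∈ s, j < k * k) ∧
      (∀ j ∈ s, F j = J j ∨ (F j).1 = (J j).1 + 1 ∧ IsSubinterval (J j) (F j) ∧
        (F j).2 / 8 = (J j).2) ∧
      ∀ j ∈ s, ∀ j' ∈ s, j ≠ j' → IntervalDisjoint (F j) (F j') := by
  classical
  let anc : ℕ → Finset ℕ := fun i => (Finset.range i).filter fun j => IsSubinterval (J j) (J i)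
  by_cases hc : ∃ i < k * k, k ≤ (anc i).card
  · obtain ⟨i, hi, hk⟩ := hc
    obtain ⟨s, hs, hsk⟩ := Finset.exists_subset_card_eq hk
    choose F hF using fun j => IsSubinterval.exists_child (J j) (J i)
    have hsi : ∀ j ∈ s, j < i ∧ IsSubinterval (J j) (J i) := fun j hj => by
      simpa [anc] using hs hj
    have key : ∀ j ∈ s, ∀ j' ∈ s, j < j' → IntervalDisjoint (F j) (F j') := by
      intro j _ j' hj' hlt L hL hL'
      refine (hF j).2.2.2 (IsSubinterval.trans (hL.of_le ((hF j').2.1.trans hL') ?_) (hsi j' hj').2)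
      rw [(hF j).1, hJ, hJ]
      omega
    refine ⟨s, F, hsk, fun j hj => (hsi j hj).1.trans hi,
      fun j _ => Or.inr ⟨(hF j).1, (hF j).2.1, (hF j).2.2.1⟩, fun j hj j' hj' hne => ?_⟩
    rcases hne.lt_or_gt with h | h
    · exact key j hj j' hj' h
    · exact fun L hL hL' => key j' hj' j hj h L hL' hL
  · push Not at hc
    rcases Nat.eq_zero_or_pos k with rfl | hkpos
    · exact ⟨∅, J, by simp⟩
    obtain ⟨y, -, hy⟩ := Finset.exists_le_card_fiber_of_mul_le_card_of_maps_to
      (s := Finset.range (k * k)) (t := Finset.range k) (f := fun i => (anc i).card) (n := k)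
      (fun i hi => Finset.mem_range.mpr (hc i (Finset.mem_range.mp hi)))
      ⟨0, Finset.mem_range.mpr hkpos⟩ (by simp)
    obtain ⟨s, hs, hsk⟩ := Finset.exists_subset_card_eq hy
    have hsy : ∀ j ∈ s, j < k * k ∧ (anc j).card = y := fun j hj => by
      simpa using hs hj
    have key : ∀ j ∈ s, ∀ j' ∈ s, j < j' → IntervalDisjoint (J j) (J j') := by
      intro j hj j' hj' hlt L hL hL'
      have hsub : IsSubinterval (J j) (J j') := hL.of_le hL' (by rw [hJ, hJ]; omega)
      have : anc j ⊂ anc j' := by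
        rw [Finset.ssubset_iff_of_subset]
        · exact ⟨j, by simp [anc, hlt, hsub], by simp [anc]⟩
        · intro l hl
          simp only [anc, Finset.mem_filter, Finset.mem_range] at hl ⊢
          exact ⟨hl.1.trans hlt, hl.2.trans hsub⟩
      have := Finset.card_lt_card this
      rw [(hsy j hj).2, (hsy j' hj').2] at this
      exact lt_irrefl _ this
    refine ⟨s, J, hsk, fun j hj => (hsy j hj).1, fun j _ => Or.inl rfl, fun j hj j' hj' hne => ?_⟩
    rcases hne.lt_or_gt with h | h
    · exact key j hj j' hj' h
    · exact fun L hL hL' => key j' hj' j hj h L hL' hL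

theorem exists_tail_sum_lt_one (M : ℝ) (d : ℕ) : ∃ D : ℕ, ∀ r : ℕ,
    ∑ j ∈ Finset.Ioc D r, M * ((j : ℝ) + 1) ^ d * (1 / 8) ^ j < 1 := by
  have h := summable_pow_mul_geometric_of_norm_lt_one (R := ℝ) d (r := 1 / 8) (by norm_num)
  have h' : Summable fun j : ℕ => M * ((j : ℝ) + 1) ^ d * (1 / 8) ^ j := by
    refine (((summable_nat_add_iff 1).mpr h).mul_left (8 * M)).congr fun j => ?_
    push_cast
    ring
  obtain ⟨s, hs⟩ := summable_iff_vanishing_norm.mp h' 1 one_pos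
  refine ⟨s.sup id, fun r => (le_abs_self _).trans_lt (hs _ ?_)⟩
  rw [Finset.disjoint_left]
  intro j hj hj'
  have := Finset.le_sup (f := id) hj'
  simp only [id, Finset.mem_Ioc] at this hj
  omega

theorem card_filter_add_div_eq_le (N c m y : ℕ) (hm : 0 < m) :
    ((Finset.range N).filter fun i => (c + i) / m = y).card ≤ m := by
  calc _ ≤ (Finset.Ico (y * m) (y * m + m)).card := by
        refine Finset.card_le_card_of_injOn (fun i => c + i) (fun i hi => ?_)
          (fun i _ j _ h => by simpa using h)
        have hi' := (Finset.mem_filter.mp hi).2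
        rw [Nat.div_eq_iff hm] at hi'
        simp only [Finset.coe_Ico, Set.mem_Ico]
        omega
    _ = m := by simp

section Tree

variable {T : Type*} {G : SimpleGraph T} {φ : ℕ × ℕ → T} {K d : ℕ}

/-- Every interval has subintervals of every smaller size whose image in the tree is uniformly
close to its own: otherwise the image of a whole row lies in a single far branch, and the vertical
rays must all enter this branch, through polynomially many intervals of small total length. -/
theorem exists_subinterval_close (hG : G.IsTree)
    (hh : ∀ n a, G.dist (φ (n, a)) (φ (n, a + 1)) ≤ K)
    (hv : ∀ n a, G.dist (φ (n, a / 8)) (φ (n + 1, a)) ≤ K)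
    (hcount : ∀ ρ : ℕ, ∃ M : ℝ, ∀ (v : T) (I : ℕ × ℕ) (R : ℕ) (S : Finset (ℕ × ℕ)),
      (∀ J ∈ S, IsSubinterval I J ∧ J.1 ≤ I.1 + R ∧ G.dist v (φ J) ≤ ρ) →
      (S.card : ℝ) ≤ M * ((R : ℝ) + 1) ^ d) :
    ∃ s : ℕ, ∀ (I : ℕ × ℕ) (r : ℕ), ∃ J, J.1 = I.1 + r ∧ IsSubinterval I J ∧
      G.dist (φ I) (φ J) ≤ s := by
  classical
  obtain ⟨M, hM⟩ := hcount (2 * K)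
  obtain ⟨D, hD⟩ := exists_tail_sum_lt_one M d
  refine ⟨K * D + K, ?_⟩
  rintro ⟨n, a⟩ r
  by_contra! hcon
  set t := φ (n, a) with ht
  obtain ⟨anc, hanc, hanc'⟩ := hG.exists_coarse_ancestor t
  have htri : ∀ u w, G.dist t w ≤ G.dist t u + G.dist u w := fun u w =>
    hG.connected.dist_triangle
  -- the interval of relative level `j` containing the `i`-th interval of the bottom row
  let J : ℕ → ℕ → ℕ × ℕ := fun j i => (n + j, (8 ^ r * a + i) / 8 ^ (r - j))
  have hJsub : ∀ j i, j ≤ r → i < 8 ^ r → IsSubinterval (n, a) (J j i) := by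
    intro j i hj hi
    refine ⟨Nat.le_add_right n j, ?_⟩
    simp only [J, Nat.add_sub_cancel_left]
    rw [Nat.div_div_eq_div_mul, ← pow_add, Nat.sub_add_cancel hj,
      Nat.mul_add_div (by positivity), Nat.div_eq_of_lt hi, add_zero]
  have hJ0 : ∀ i, i < 8 ^ r → J 0 i = (n, a) := fun i hi =>
    ((hJsub 0 i (Nat.zero_le r) hi).eq_of_fst_eq rfl).symm
  have hJstep : ∀ j i, j < r → G.dist (φ (J j i)) (φ (J (j + 1) i)) ≤ K := by
    intro j i hj
    have := hv (n + j) ((8 ^ r * a + i) / 8 ^ (r - (j + 1)))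
    rw [Nat.div_div_eq_div_mul, ← pow_succ, show r - (j + 1) + 1 = r - j by omega] at this
    exact this
  have hJdist : ∀ j i, j ≤ r → i < 8 ^ r → G.dist t (φ (J j i)) ≤ K * j := by
    intro j i hj hi
    induction j with
    | zero => rw [hJ0 i hi, SimpleGraph.dist_self]; exact Nat.zero_le _
    | succ j ih =>
      have h₁ := ih (by omega)
      have h₂ := hJstep j i (by omega)
      have h₃ := htri (φ (J j i)) (φ (J (j + 1) i))
      rw [Nat.mul_succ]
      omega
  have hbot : ∀ i, i < 8 ^ r → K * D + K < G.dist t (φ (J r i)) := fun i hi =>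
    hcon (J r i) rfl (hJsub r i le_rfl hi)
  have hrow : ∀ i, i < 8 ^ r → anc (K * D) (φ (J r i)) = anc (K * D) (φ (J r 0)) := by
    intro i hi
    induction i with
    | zero => rfl
    | succ i ih =>
      rw [← ih (by omega)]
      refine (hanc' (K * D) K _ _ ?_ (hbot i (by omega)).le).symm
      simpa [J, add_assoc] using hh (n + r) (8 ^ r * a + i)
  set v := anc (K * D) (φ (J r 0))
  let P : ℕ × ℕ → Prop := fun L => K * D + K < G.dist t (φ L) ∧
    G.dist t (φ L) ≤ K * D + K + K ∧ anc (K * D) (φ L) = v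
  have hray : ∀ i, i < 8 ^ r → ∃ j ∈ Finset.Ioc D r, P (J j i) := by
    intro i hi
    let Q : ℕ → Prop := fun j =>
      K * D + K < G.dist t (φ (J j i)) ∧ anc (K * D) (φ (J j i)) = v
    have hex : ∃ j, Q j ∧ j ≤ r := ⟨r, ⟨hbot i hi, hrow i hi⟩, le_rfl⟩
    obtain ⟨⟨hfar, hv'⟩, hjr⟩ := Nat.find_spec hex
    have hmin := fun j => Nat.find_min hex (m := j)
    set j := Nat.find hex
    have hDj : D < j := by
      have := hJdist j i hjr hi
      by_contra hle
      have := Nat.mul_le_mul_left K (not_lt.mp hle)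
      omega
    refine ⟨j, Finset.mem_Ioc.mpr ⟨hDj, hjr⟩, hfar, ?_, hv'⟩
    obtain ⟨l, hl⟩ : ∃ l, j = l + 1 := ⟨j - 1, by omega⟩
    have hst := hJstep l i (by omega)
    have h₃ := htri (φ (J l i)) (φ (J (l + 1) i))
    rw [← hl] at hst h₃
    by_contra hlt
    refine hmin l (by omega) ⟨⟨by omega, ?_⟩, by omega⟩
    rw [← hv']
    exact hanc' _ K _ _ hst (by omega)
  have hcover : Finset.range (8 ^ r) ⊆ (Finset.Ioc D r).biUnion fun j =>
      (Finset.range (8 ^ r)).filter fun i => P (J j i) := by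
    intro i hi
    obtain ⟨j, hj, hP⟩ := hray i (Finset.mem_range.mp hi)
    exact Finset.mem_biUnion.mpr ⟨j, hj, Finset.mem_filter.mpr ⟨hi, hP⟩⟩
  have hlevel : ∀ j ∈ Finset.Ioc D r,
      (((Finset.range (8 ^ r)).filter fun i => P (J j i)).card : ℝ) ≤
        8 ^ r * (M * ((j : ℝ) + 1) ^ d * (1 / 8) ^ j) := by
    intro j hj
    have hjr := (Finset.mem_Ioc.mp hj).2
    have h₁ := Finset.card_le_mul_card_image (f := J j)
      ((Finset.range (8 ^ r)).filter fun i => P (J j i)) (8 ^ (r - j)) (by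
        intro y _
        refine (Finset.card_le_card ?_).trans
          (card_filter_add_div_eq_le (8 ^ r) (8 ^ r * a) (8 ^ (r - j)) y.2 (by positivity))
        intro i hi
        simp only [Finset.mem_filter] at hi ⊢
        exact ⟨hi.1.1, congrArg Prod.snd hi.2⟩)
    have h₂ := hM v (n, a) j
      (((Finset.range (8 ^ r)).filter fun i => P (J j i)).image (J j)) (by
        intro L hL
        obtain ⟨i, hi, rfl⟩ := Finset.mem_image.mp hL
        obtain ⟨hi, hfar, hnear, hv'⟩ := Finset.mem_filter.mp hi
        refine ⟨hJsub j i hjr (Finset.mem_range.mp hi), le_rfl, ?_⟩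
        have := hanc (K * D) (φ (J j i)) (by omega)
        rw [hv'] at this
        omega)
    have h₃ : (8 : ℝ) ^ r = 8 ^ (r - j) * 8 ^ j := by rw [← pow_add, Nat.sub_add_cancel hjr]
    have h₄ : (8 : ℝ) ^ j * (1 / 8) ^ j = 1 := by rw [← mul_pow]; norm_num
    refine (Nat.cast_le.mpr h₁).trans ?_
    push_cast
    calc _ ≤ (8 : ℝ) ^ (r - j) * (M * ((j : ℝ) + 1) ^ d) := by gcongr
      _ = _ := by
        rw [h₃]
        linear_combination (-(8 : ℝ) ^ (r - j) * (M * ((j : ℝ) + 1) ^ d)) * h₄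
  have hcard : ((8 : ℝ) ^ r) ≤ 8 ^ r *
      ∑ j ∈ Finset.Ioc D r, M * ((j : ℝ) + 1) ^ d * (1 / 8) ^ j := by
    rw [Finset.mul_sum]
    refine le_trans ?_ (Finset.sum_le_sum hlevel)
    have := (Finset.card_le_card hcover).trans Finset.card_biUnion_le
    rw [Finset.card_range] at this
    exact_mod_cast this
  have := hD r
  have h8 : (0 : ℝ) < 8 ^ r := by positivity
  nlinarith

/-- The number of subintervals of depth polynomial in `k` on which `φ` stays within bounded distance
of its value at `I` grows at least as fast as any power of `k`. -/
theorem exists_pow_le_card_subintervals (hG : G.IsTree)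
    (hv : ∀ n a, G.dist (φ (n, a / 8)) (φ (n + 1, a)) ≤ K) {s : ℕ}
    (hs : ∀ (I : ℕ × ℕ) (r : ℕ), ∃ J, J.1 = I.1 + r ∧ IsSubinterval I J ∧
      G.dist (φ I) (φ J) ≤ s) (k m : ℕ) (I : ℕ × ℕ) :
    ∃ S : Finset (ℕ × ℕ), k ^ m ≤ S.card ∧ ∀ J ∈ S, IsSubinterval I J ∧
      J.1 ≤ I.1 + m * (k * k) ∧ G.dist (φ I) (φ J) ≤ m * (s + K) := by
  classical
  induction m generalizing I with
  | zero =>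
    refine ⟨{I}, by simp, fun J hJ => ?_⟩
    rw [Finset.mem_singleton.mp hJ]
    exact ⟨.refl I, by simp, by simp⟩
  | succ m ih =>
    choose J hJlevel hJsub hJdist using hs I
    obtain ⟨σ, F, hσ, hσk, hF, hdisj⟩ := exists_disjoint_subintervals I.1 k J hJlevel
    choose S hScard hS using ih
    have hF' : ∀ j ∈ σ, IsSubinterval I (F j) ∧ (F j).1 ≤ I.1 + k * k ∧
        G.dist (φ I) (φ (F j)) ≤ s + K := by
      intro j hj
      have h₁ := hσk j hj
      have h₂ := hJlevel j
      have h₃ := hJdist j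
      rcases hF j hj with h | ⟨hl, hsub, hdiv⟩
      · rw [h]
        exact ⟨hJsub j, by omega, by omega⟩
      · refine ⟨(hJsub j).trans hsub, by omega, ?_⟩
        have h₄ := hv (J j).1 (F j).2
        rw [hdiv, ← hl] at h₄
        have h₅ : G.dist (φ I) (φ (F j)) ≤ _ := hG.connected.dist_triangle (v := φ (J j))
        exact h₅.trans (add_le_add h₃ h₄)
    refine ⟨σ.biUnion fun j => S (F j), ?_, fun L hL => ?_⟩
    · rw [Finset.card_biUnion]
      · calc k ^ (m + 1) = ∑ _j ∈ σ, k ^ m := by simp [hσ, pow_succ, mul_comm]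
          _ ≤ _ := Finset.sum_le_sum fun j _ => hScard (F j)
      · intro j hj j' hj' hne
        rw [Function.onFun, Finset.disjoint_left]
        exact fun L hL hL' => hdisj j hj j' hj' hne L (hS _ L hL).1 (hS _ L hL').1
    · obtain ⟨j, hj, hL⟩ := Finset.mem_biUnion.mp hL
      obtain ⟨h₁, h₂, h₃⟩ := hF' j hj
      obtain ⟨h₄, h₅, h₆⟩ := hS _ L hL
      refine ⟨h₁.trans h₄, by rw [Nat.succ_mul]; omega, ?_⟩
      rw [Nat.succ_mul, add_comm]
      exact hG.connected.dist_triangle.trans (add_le_add h₃ h₆)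

theorem not_polynomial_count_of_isTree (hG : G.IsTree)
    (hh : ∀ n a, G.dist (φ (n, a)) (φ (n, a + 1)) ≤ K)
    (hv : ∀ n a, G.dist (φ (n, a / 8)) (φ (n + 1, a)) ≤ K) :
    ¬ ∀ ρ : ℕ, ∃ M : ℝ, ∀ (v : T) (I : ℕ × ℕ) (R : ℕ) (S : Finset (ℕ × ℕ)),
      (∀ J ∈ S, IsSubinterval I J ∧ J.1 ≤ I.1 + R ∧ G.dist v (φ J) ≤ ρ) →
      (S.card : ℝ) ≤ M * ((R : ℝ) + 1) ^ d := by
  intro hcount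
  obtain ⟨s, hs⟩ := exists_subinterval_close hG hh hv hcount
  obtain ⟨M, hM⟩ := hcount ((2 * d + 1) * (s + K))
  have hbound : ∀ k : ℕ, 1 ≤ k → (k : ℝ) ≤ M * (2 * d + 2) ^ d := by
    intro k hk
    have hk' : (1 : ℝ) ≤ k := by exact_mod_cast hk
    obtain ⟨S, hcard, hS⟩ := exists_pow_le_card_subintervals hG hv hs k (2 * d + 1) (0, 0)
    have h := hM _ (0, 0) _ S hS
    have hM0 : 0 ≤ M := by simpa using hM (φ (0, 0)) (0, 0) 0 ∅ (by simp)
    have hle : ((k : ℝ) ^ (2 * d)) * k ≤ k ^ (2 * d) * (M * (2 * d + 2) ^ d) := by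
      calc ((k : ℝ) ^ (2 * d)) * k = ((k ^ (2 * d + 1) : ℕ) : ℝ) := by push_cast; ring
        _ ≤ S.card := by exact_mod_cast hcard
        _ ≤ _ := h
        _ ≤ M * ((2 * d + 2) * k ^ 2) ^ d := by
            gcongr
            push_cast
            nlinarith
        _ = _ := by rw [mul_pow, ← pow_mul]; ring
    exact le_of_mul_le_mul_left hle (by positivity)
  obtain ⟨k, hk⟩ := exists_nat_gt (M * (2 * d + 2) ^ d)
  have h := hbound (k + 1) (by omega)
  push_cast at h
  linarith

end Tree

namespace UpperHalfPlane

/-- The point `(a + i / 4) / 8 ^ n` attached to the interval `(n, a)`. -/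
noncomputable def netPoint (J : ℕ × ℕ) : UpperHalfPlane :=
  .mk ⟨(J.2 : ℝ) / 8 ^ J.1, 1 / 4 / 8 ^ J.1⟩ (by simp)

theorem netPoint_re (J : ℕ × ℕ) : (netPoint J).re = (J.2 : ℝ) / 8 ^ J.1 := rfl

theorem netPoint_im (J : ℕ × ℕ) : (netPoint J).im = 1 / 4 / 8 ^ J.1 := rfl

theorem dist_le_of_abs_sub_le {z w : UpperHalfPlane} {y c : ℝ} (hy : 0 < y) (hz : y ≤ z.im)
    (hw : y ≤ w.im) (h : |z.re - w.re| + |z.im - w.im| ≤ c * y) : dist z w ≤ c := by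
  have hy' : y ≤ √(z.im * w.im) :=
    Real.le_sqrt_of_sq_le (by rw [sq]; exact mul_le_mul hz hw hy.le z.im_pos.le)
  have hd : dist (z : ℂ) w ≤ |z.re - w.re| + |z.im - w.im| := by
    rw [Complex.dist_eq]
    exact Complex.norm_le_abs_re_add_abs_im _
  have hc : 0 ≤ c * y := le_trans (by positivity) h
  calc dist z w ≤ dist (z : ℂ) w / √(z.im * w.im) := dist_le_dist_coe_div_sqrt z w
    _ ≤ c * y / y := by gcongr; exact hd.trans h
    _ = c := mul_div_cancel_right₀ c hy.ne'

theorem dist_netPoint_right (n a : ℕ) : dist (netPoint (n, a)) (netPoint (n, a + 1)) ≤ 35 := by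
  have h8 : (0 : ℝ) < 8 ^ n := by positivity
  refine dist_le_of_abs_sub_le (y := 1 / 4 / 8 ^ n) (by positivity) le_rfl le_rfl ?_
  simp only [netPoint_re, netPoint_im]
  rw [sub_self, abs_zero, add_zero, ← sub_div, abs_div, abs_of_pos h8, mul_div_assoc', Nat.cast_add]
  gcongr
  norm_num

theorem dist_netPoint_child (n a : ℕ) :
    dist (netPoint (n, a / 8)) (netPoint (n + 1, a)) ≤ 35 := by
  have h8 : (0 : ℝ) < 8 ^ n := by positivity
  refine dist_le_of_abs_sub_le (y := 1 / 4 / 8 ^ (n + 1)) (by positivity) ?_ le_rfl ?_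
  · rw [netPoint_im]
    gcongr <;> norm_num
  · simp only [netPoint_re, netPoint_im]
    have ha : (a : ℝ) = 8 * (a / 8 : ℕ) + (a % 8 : ℕ) := by exact_mod_cast (Nat.div_add_mod a 8).symm
    have hm : ((a % 8 : ℕ) : ℝ) ≤ 7 := by exact_mod_cast Nat.le_of_lt_succ (Nat.mod_lt a (by norm_num))
    have h₁ : ((a / 8 : ℕ) : ℝ) / 8 ^ n - a / 8 ^ (n + 1) = -((a % 8 : ℕ) / 8 ^ (n + 1)) := by
      rw [ha, pow_succ]
      field_simp
      simp
    have h₂ : (1 / 4 / 8 ^ n - 1 / 4 / 8 ^ (n + 1) : ℝ) = 7 / 4 / 8 ^ (n + 1) := by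
      rw [pow_succ]
      field_simp
      norm_num
    rw [h₁, h₂, abs_neg, abs_of_nonneg (by positivity), abs_of_nonneg (by positivity), ← add_div,
      mul_div_assoc']
    gcongr
    linarith

theorem dist_netPoint_le {I J : ℕ × ℕ} (h : IsSubinterval I J) {R : ℕ} (hR : J.1 ≤ I.1 + R) :
    dist (netPoint I) (netPoint J) ≤ 35 * R := by
  induction R generalizing J with
  | zero =>
    rw [h.eq_of_fst_eq (le_antisymm h.1 hR)]
    simp
  | succ R ih =>
    rcases hR.lt_or_eq with hlt | heq
    · refine (ih h (by omega)).trans ?_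
      push_cast
      linarith
    · obtain ⟨n, a⟩ := J
      obtain ⟨l, rfl⟩ : ∃ l, n = l + 1 := ⟨n - 1, by dsimp only at heq; omega⟩
      have hp : IsSubinterval (l, a / 8) (l + 1, a) := ⟨Nat.le_succ l, by simp⟩
      have h₁ := ih (J := (l, a / 8)) (h.of_le hp (by dsimp only at heq ⊢; omega))
        (by dsimp only at heq ⊢; omega)
      have h₂ := dist_netPoint_child l a
      have h₃ := dist_triangle (netPoint I) (netPoint (l, a / 8)) (netPoint (l + 1, a))
      push_cast
      linarith

theorem two_le_dist_netPoint {I J : ℕ × ℕ} (hne : I ≠ J) :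
    2 ≤ dist (netPoint I) (netPoint J) := by
  have hexp : Real.exp 2 < 8 := by
    have h := Real.exp_one_lt_d9
    have h0 := Real.exp_pos 1
    rw [show (2 : ℝ) = 1 + 1 by norm_num, Real.exp_add]
    nlinarith
  have hlevel : ∀ I J : ℕ × ℕ, I.1 < J.1 → 2 ≤ dist (netPoint I) (netPoint J) := by
    intro I J hlt
    by_contra! hd
    have h₁ := im_le_im_mul_exp_dist (netPoint I) (netPoint J)
    have h₂ : Real.exp (dist (netPoint I) (netPoint J)) < 8 := (Real.exp_lt_exp.mpr hd).trans hexp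
    have h₃ : (netPoint J).im * 8 ≤ (netPoint I).im := by
      rw [netPoint_im, netPoint_im, div_mul_eq_mul_div, div_le_div_iff₀ (by positivity)
        (by positivity)]
      have : (8 : ℝ) ^ (I.1 + 1) ≤ 8 ^ J.1 := pow_le_pow_right₀ (by norm_num) hlt
      rw [pow_succ] at this
      linarith
    have := mul_lt_mul_of_pos_left h₂ (netPoint J).im_pos
    linarith
  rcases lt_trichotomy I.1 J.1 with h | h | h
  · exact hlevel I J h
  · by_contra! hd
    have hcosh : Real.cosh (dist (netPoint I) (netPoint J)) < 9 := by
      have h₁ := Real.exp_lt_exp.mpr hd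
      have h₂ : Real.exp (-dist (netPoint I) (netPoint J)) ≤ 1 :=
        Real.exp_le_one_iff.mpr (neg_nonpos.mpr dist_nonneg)
      rw [Real.cosh_eq]
      linarith
    rw [cosh_dist, netPoint_im, netPoint_im, ← h] at hcosh
    have h8 : (0 : ℝ) < 8 ^ I.1 := by positivity
    have hre : 1 / 8 ^ I.1 ≤ dist (netPoint I : ℂ) (netPoint J) := by
      have h₁ := Complex.abs_re_le_norm ((netPoint I : ℂ) - netPoint J)
      rw [← Complex.dist_eq, Complex.sub_re, coe_re, coe_re, netPoint_re, netPoint_re, ← h,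
        ← sub_div, abs_div, abs_of_pos h8] at h₁
      refine le_trans ?_ h₁
      gcongr
      have hne' : (I.2 : ℤ) - J.2 ≠ 0 := fun h' => hne (Prod.ext h (by omega))
      exact_mod_cast Int.one_le_abs hne'
    have hsq : (1 / 8 ^ I.1) ^ 2 ≤ dist (netPoint I : ℂ) (netPoint J) ^ 2 := by gcongr
    have : 8 ≤ dist (netPoint I : ℂ) (netPoint J) ^ 2 /
        (2 * (1 / 4 / 8 ^ I.1) * (1 / 4 / 8 ^ I.1)) := by
      rw [le_div_iff₀ (by positivity)]
      refine le_trans (le_of_eq ?_) hsq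
      field_simp
      norm_num
    linarith
  · rw [dist_comm]
    exact hlevel J I h

/-- Regular maps are uniformly finite-to-one on the net. -/
theorem card_netPoint_fiber_le {Y : Type*} [MetricSpace Y] {f : UpperHalfPlane → Y} {κ : ℕ} {y : Y}
    {c : Finset UpperHalfPlane} (hc : c.card ≤ κ)
    (hsub : f ⁻¹' Metric.ball y 1 ⊆ ⋃ x ∈ c, Metric.ball x 1) {S : Finset (ℕ × ℕ)}
    (hS : ∀ J ∈ S, f (netPoint J) = y) : S.card ≤ κ := by
  have hex : ∀ J ∈ S, ∃ x ∈ c, netPoint J ∈ Metric.ball x 1 := by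
    intro J hJ
    have : netPoint J ∈ f ⁻¹' Metric.ball y 1 := by
      rw [Set.mem_preimage, hS J hJ]
      exact Metric.mem_ball_self one_pos
    simpa using hsub this
  choose! g hg hball using hex
  refine (Finset.card_le_card_of_injOn g hg fun I hI J hJ hIJ => ?_).trans hc
  by_contra hne
  have h₁ := hball I hI
  have h₂ := hball J hJ
  rw [← hIJ] at h₂
  have h₃ := two_le_dist_netPoint hne
  have h₄ := dist_triangle_right (netPoint I) (netPoint J) (g I)
  rw [Metric.mem_ball] at h₁ h₂
  linarith

end UpperHalfPlane

open UpperHalfPlane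

/-- There is no regular map from the hyperbolic plane `ℍ²` to `T₃ × Z`,
where `T₃` is the 3-regular tree and `Z` is a connected bounded degree graph of polynomial
growth, with the ℓ¹ product metric on `T₃ × Z`. -/
theorem no_regular_map_H2_to_T3_times_polynomial
    (T Z P : Type*) [MetricSpace T] [MetricSpace Z] [MetricSpace P]
    (hT : IsCubicTreeMetric T)
    (hZ : IsBddDegGraphMetric Z) (hZgrowth : HasPolyGrowth Z)
    (e : P ≃ T × Z)
    (hP : ∀ p q : P, dist p q = dist (e p).1 (e q).1 + dist (e p).2 (e q).2) :
    ¬ ∃ f : UpperHalfPlane → P, IsRegularMap f := by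
  classical
  rintro ⟨f, κ, -, hlip, hfib⟩
  obtain ⟨G, hconn, hacyc, hdeg, hdist⟩ := hT
  obtain ⟨C, d, hC, hgrow⟩ := hZgrowth
  have hstep : ∀ I J, dist (netPoint I) (netPoint J) ≤ 35 →
      G.dist (e (f (netPoint I))).1 (e (f (netPoint J))).1 ≤ κ * 36 := by
    intro I J h
    have h₁ := hlip (netPoint I) (netPoint J)
    rw [hP] at h₁
    have h₂ : (κ : ℝ) * (1 + dist (netPoint I) (netPoint J)) ≤ κ * 36 := by gcongr; linarith
    have h₃ : dist (e (f (netPoint I))).1 (e (f (netPoint J))).1 ≤ κ * 36 := by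
      have := dist_nonneg (x := (e (f (netPoint I))).2) (y := (e (f (netPoint J))).2)
      linarith
    rw [hdist] at h₃
    exact_mod_cast h₃
  refine not_polynomial_count_of_isTree (G := G) (φ := fun J => (e (f (netPoint J))).1)
    (K := κ * 36) (d := d) ⟨hconn, hacyc⟩ (fun n a => hstep _ _ (dist_netPoint_right n a))
    (fun n a => hstep _ _ (dist_netPoint_child n a)) fun ρ => ?_
  refine ⟨κ * (4 ^ ρ * (C * (κ * 36) ^ d + C)), fun v I R S hS => ?_⟩
  obtain ⟨B, hB, hmem⟩ := hconn.exists_card_ball_le hdeg v ρ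
  set B' := S.image fun J => (e (f (netPoint J))).2 with hB'
  have hB'card : (B'.card : ℝ) ≤ (C * (κ * 36) ^ d + C) * ((R : ℝ) + 1) ^ d := by
    refine (hgrow (e (f (netPoint I))).2 (κ * 36 * (R + 1)) (by positivity) B' ?_).trans ?_
    · intro z hz
      obtain ⟨J, hJ, rfl⟩ := Finset.mem_image.mp (Finset.mem_coe.mp hz)
      obtain ⟨hsub, hlev, -⟩ := hS J hJ
      have h₁ := hlip (netPoint I) (netPoint J)
      rw [hP] at h₁
      have h₂ := dist_netPoint_le hsub hlev
      have h₃ : (κ : ℝ) * (1 + dist (netPoint I) (netPoint J)) ≤ κ * (36 * (R + 1)) := by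
        gcongr
        linarith
      rw [Metric.mem_closedBall, dist_comm]
      have := dist_nonneg (x := (e (f (netPoint I))).1) (y := (e (f (netPoint J))).1)
      linarith
    · have h₁ : (1 : ℝ) ≤ ((R : ℝ) + 1) ^ d := one_le_pow₀ (by simp)
      dsimp only
      rw [mul_pow _ ((R : ℝ) + 1) d]
      nlinarith
  have himage : (S.image fun J => f (netPoint J)).card ≤ 4 ^ ρ * B'.card := by
    calc _ ≤ (B ×ˢ B').card := by
          refine Finset.card_le_card_of_injOn e (fun p hp => ?_) e.injective.injOn
          obtain ⟨J, hJ, rfl⟩ := Finset.mem_image.mp (Finset.mem_coe.mp hp)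
          exact Finset.mem_coe.mpr (Finset.mem_product.mpr
            ⟨hmem _ (hS J hJ).2.2, Finset.mem_image_of_mem _ hJ⟩)
      _ ≤ _ := by
          rw [Finset.card_product]
          exact Nat.mul_le_mul_right _ hB
  have hScard : S.card ≤ κ * (S.image fun J => f (netPoint J)).card := by
    refine Finset.card_le_mul_card_image S κ fun y _ => ?_
    obtain ⟨c, hc, hsub⟩ := hfib y
    exact card_netPoint_fiber_le hc hsub fun J hJ => (Finset.mem_filter.mp hJ).2
  calc (S.card : ℝ) ≤ κ * (4 ^ ρ * B'.card) := by
        exact_mod_cast hScard.trans (Nat.mul_le_mul_left κ himage)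
    _ ≤ κ * (4 ^ ρ * ((C * (κ * 36) ^ d + C) * ((R : ℝ) + 1) ^ d)) := by gcongr
    _ = _ := by ring
end

section
/- There is no quasi-isometric embedding from the hyperbolic plane ℍ² to T₃ × Z, where T₃ is the 3-regular tree and Z is the vertex set of a connected simple graph of uniformly bounded degree of subexponential growth (i.e. there is a non-decreasing function g with (1/r)·log g(r) → 0 as r → ∞ such that every ball of radius r in Z contains at most g(r) vertices), with the ℓ¹ product metric on T₃ × Z. -/
open Metric Set

namespace SimpleGraph

variable {V : Type*} {G : SimpleGraph V}

/-- The vertices closer to `w` than to `u`: for an edge `uw` of a tree, one of its two sides. -/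
def nearSide (G : SimpleGraph V) (u w : V) : Set V := {t | G.dist t w < G.dist t u}

theorem mem_nearSide {u w t : V} : t ∈ G.nearSide u w ↔ G.dist t w < G.dist t u := Iff.rfl

theorem Connected.exists_adj_dist_lt (hG : G.Connected) {t u : V} (h : t ≠ u) :
    ∃ w, G.Adj u w ∧ G.dist t w < G.dist t u := by
  obtain ⟨p, hp⟩ := hG.exists_walk_length_eq_dist u t
  cases p with
  | nil => exact absurd rfl h
  | cons hadj q =>
    refine ⟨_, hadj, ?_⟩
    have := dist_le q
    rw [Walk.length_cons] at hp
    rw [dist_comm, dist_comm (u := t)]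
    omega

theorem Walk.dist_le_of_mem_support {a b v : V} (p : G.Walk a b) (hv : v ∈ p.support) :
    G.dist a v + G.dist v b ≤ p.length := by
  classical
  have h := congrArg Walk.length (p.take_spec hv)
  rw [Walk.length_append] at h
  have h1 := dist_le (p.takeUntil v hv)
  have h2 := dist_le (p.dropUntil v hv)
  omega

theorem IsAcyclic.eq_of_adj_of_mem_nearSide (hG : G.Connected) (hA : G.IsAcyclic) {u w a b : V}
    (huw : G.Adj u w) (hab : G.Adj a b) (ha : a ∈ G.nearSide u w) (hb : b ∉ G.nearSide u w) :
    a = w ∧ b = u := by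
  by_contra hne
  have hbr := isBridge_iff_forall_walk_mem_edges.1
    (isAcyclic_iff_forall_adj_isBridge.1 hA huw)
  rw [mem_nearSide] at ha hb
  obtain ⟨p, hp⟩ := hG.exists_walk_length_eq_dist a w
  obtain ⟨q, hq⟩ := hG.exists_walk_length_eq_dist b u
  have hwu : G.dist w u = 1 := dist_eq_one_iff_adj.2 huw.symm
  have hpu : u ∉ p.support := fun h => by
    have := p.dist_le_of_mem_support h
    omega
  have hqw : w ∉ q.support := fun h => by
    have := q.dist_le_of_mem_support h
    omega
  have hmem := hbr ((p.reverse.append (Walk.cons hab q)).reverse)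
  simp only [Walk.edges_reverse, Walk.edges_append, Walk.edges_cons, List.mem_reverse,
    List.mem_append, List.mem_cons] at hmem
  rcases hmem with h | h | h
  · exact hpu (p.fst_mem_support_of_mem_edges h)
  · rw [Sym2.eq_iff] at h
    rcases h with ⟨rfl, rfl⟩ | ⟨rfl, rfl⟩
    · exact absurd ha (by simp)
    · exact hne ⟨rfl, rfl⟩
  · exact hqw (q.snd_mem_support_of_mem_edges h)

theorem IsAcyclic.dist_le_of_mem_nearSide (hG : G.Connected) (hA : G.IsAcyclic) {u w a b : V}
    (huw : G.Adj u w) (ha : a ∈ G.nearSide u w) (hb : b ∉ G.nearSide u w) :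
    G.dist a u + G.dist b u ≤ G.dist a b := by
  obtain ⟨p, hp⟩ := hG.exists_walk_length_eq_dist a b
  obtain ⟨d, hd, h1, h2⟩ := p.exists_boundary_dart _ ha hb
  have hu := (hA.eq_of_adj_of_mem_nearSide hG huw d.adj h1 h2).2
  have := p.dist_le_of_mem_support (hu ▸ p.dart_snd_mem_support_of_mem_darts hd)
  rw [dist_comm (u := b)]
  omega

theorem IsAcyclic.dist_le_of_not_mem_nearSide_iff (hG : G.Connected) (hA : G.IsAcyclic)
    {u w a b : V} (huw : G.Adj u w) (h : ¬ (a ∈ G.nearSide u w ↔ b ∈ G.nearSide u w)) :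
    G.dist a u + G.dist b u ≤ G.dist a b := by
  by_cases ha : a ∈ G.nearSide u w
  · exact hA.dist_le_of_mem_nearSide hG huw ha (by tauto)
  · rw [add_comm, dist_comm (u := a) (v := b)]
    exact hA.dist_le_of_mem_nearSide hG huw (by tauto) ha

theorem Connected.exists_card_le_of_isRegularOfDegree [G.LocallyFinite] {k : ℕ}
    (hG : G.Connected) (hk : G.IsRegularOfDegree k) (u : V) (n : ℕ) :
    ∃ s : Finset V, s.card ≤ (k + 1) ^ n ∧ ∀ v, G.dist v u ≤ n → v ∈ s := by
  classical
  induction n with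
  | zero => exact ⟨{u}, by simp, fun v hv => by
      simpa using hG.dist_eq_zero_iff.1 (Nat.le_zero.1 hv)⟩
  | succ n ih =>
    obtain ⟨s, hs, h⟩ := ih
    refine ⟨s.biUnion fun v => insert v (G.neighborFinset v), ?_, fun v hv => ?_⟩
    · calc _ ≤ s.card * (k + 1) := Finset.card_biUnion_le_card_mul _ _ _ fun v _ =>
            (Finset.card_insert_le _ _).trans (by rw [card_neighborFinset_eq_degree, hk v])
        _ ≤ _ := by rw [pow_succ]; gcongr
    · rw [Finset.mem_biUnion]
      rcases eq_or_ne u v with rfl | hne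
      · exact ⟨u, h u (by simp), by simp⟩
      · obtain ⟨w, hw, hlt⟩ := hG.exists_adj_dist_lt hne
        refine ⟨w, h w ?_, ?_⟩
        · rw [dist_comm (u := u), dist_comm (u := u)] at hlt
          omega
        · simp [hw.symm]

open scoped Classical in
theorem Connected.exists_balanced_edge [G.LocallyFinite] (hG : G.Connected)
    (hk : G.IsRegularOfDegree 3) {ι : Type*} (X : Finset ι) (F : ι → V) :
    ∃ u w, G.Adj u w ∧ 2 * (X.filter fun x => F x ∈ G.nearSide u w).card ≤ X.card ∧
      X.card ≤ (X.filter fun x => F x = u).card +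
        3 * (X.filter fun x => F x ∈ G.nearSide u w).card := by
  classical
  have := hG.nonempty
  obtain ⟨u, hu⟩ := WellFounded.has_min (measure fun u => ∑ x ∈ X, G.dist (F x) u).wf
    Set.univ Set.univ_nonempty
  replace hu : ∀ v, ∑ x ∈ X, G.dist (F x) u ≤ ∑ x ∈ X, G.dist (F x) v :=
    fun v => not_lt.1 (hu.2 v trivial)
  set c : V → ℕ := fun w => (X.filter fun x => F x ∈ G.nearSide u w).card with hc
  have hne : (G.neighborFinset u).Nonempty := by
    rw [← Finset.card_pos, card_neighborFinset_eq_degree, hk u]; norm_num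
  obtain ⟨w, hw, hmax⟩ := Finset.exists_max_image (G.neighborFinset u) c hne
  rw [mem_neighborFinset] at hw
  refine ⟨u, w, hw, ?_, ?_⟩
  · have hsum : ∑ x ∈ X, G.dist (F x) w +
        2 * (X.filter fun x => F x ∈ G.nearSide u w).card ≤
        ∑ x ∈ X, G.dist (F x) u + X.card := by
      rw [Finset.card_filter, Finset.mul_sum, ← Finset.sum_add_distrib, Finset.card_eq_sum_ones,
        ← Finset.sum_add_distrib]
      refine Finset.sum_le_sum fun x _ => ?_
      have h := hG.dist_triangle (u := F x) (v := u) (w := w)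
      rw [dist_eq_one_iff_adj.2 hw] at h
      simp only [mem_nearSide]
      split_ifs <;> omega
    have := hu w
    omega
  · have hsub : X ⊆ (X.filter fun x => F x = u) ∪ (G.neighborFinset u).biUnion fun w =>
        X.filter fun x => F x ∈ G.nearSide u w := by
      intro x hx
      rw [Finset.mem_union, Finset.mem_biUnion]
      by_cases h : F x = u
      · exact Or.inl (by simp [hx, h])
      · obtain ⟨v, hv, hlt⟩ := hG.exists_adj_dist_lt h
        exact Or.inr ⟨v, by simpa using hv, by simp [hx, mem_nearSide, hlt]⟩
    refine (Finset.card_le_card hsub).trans ((Finset.card_union_le _ _).trans ?_)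
    gcongr
    refine (Finset.card_biUnion_le_card_mul _ _ (c w) fun v hv => hmax v hv).trans ?_
    rw [card_neighborFinset_eq_degree, hk u]

end SimpleGraph

section Window

open scoped Classical

/-- The number of points of the window `[a, a + n)` satisfying `p`. -/
noncomputable def windowCount (p : ℕ → Prop) (a n : ℕ) : ℕ :=
  ((Finset.range n).filter fun y => p (a + y)).card

theorem count_add_windowCount (p : ℕ → Prop) (a n : ℕ) :
    Nat.count p a + windowCount p a n = Nat.count p (a + n) := by
  rw [windowCount, Nat.count_add, Nat.count_eq_card_filter_range (fun k => p (a + k))]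

theorem windowCount_mono {p q : ℕ → Prop} (h : ∀ x, p x → q x) (a n : ℕ) :
    windowCount p a n ≤ windowCount q a n :=
  Finset.card_le_card (Finset.monotone_filter_right _ fun _ _ => h _)

theorem windowCount_pos {p : ℕ → Prop} {a n y : ℕ} (hy : y < n) (hp : p (a + y)) :
    0 < windowCount p a n :=
  Finset.card_pos.2 ⟨y, by simp [hy, hp]⟩

theorem windowCount_le_of_forall {p : ℕ → Prop} {a n B : ℕ}
    (h : ∀ s ⊆ Finset.range n, (∀ y ∈ s, p (a + y)) → s.card ≤ B) : windowCount p a n ≤ B :=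
  h _ (Finset.filter_subset _ _) fun _ hy => (Finset.mem_filter.1 hy).2

theorem windowCount_eq_zero {p : ℕ → Prop} {a n : ℕ} (h : ∀ y < n, ¬ p (a + y)) :
    windowCount p a n = 0 :=
  Finset.card_eq_zero.2 (Finset.filter_eq_empty_iff.2 fun y hy => h y (Finset.mem_range.1 hy))

theorem windowCount_not (p : ℕ → Prop) (a n : ℕ) :
    windowCount p a n + windowCount (fun x => ¬ p x) a n = n := by
  have := Finset.card_filter_add_card_filter_not (s := Finset.range n) (fun y => p (a + y))
  rw [Finset.card_range] at this
  unfold windowCount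
  convert this

theorem windowCount_add_le_of_disjoint (p : ℕ → Prop) {a N b c n : ℕ} (hb : a ≤ b)
    (hbc : b + n ≤ c) (hc : c + n ≤ a + N) :
    windowCount p b n + windowCount p c n ≤ windowCount p a N := by
  have h1 := Nat.count_monotone p hb
  have h2 := Nat.count_monotone p hbc
  have h3 := Nat.count_monotone p hc
  have := count_add_windowCount p a N
  have := count_add_windowCount p b n
  have := count_add_windowCount p c n
  omega

/-- Both `p` and its negation hold on at least a quarter of the window `[a, a + 2 ^ i)`. -/
def IsBalanced (p : ℕ → Prop) (a i : ℕ) : Prop :=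
  2 ^ i ≤ 4 * windowCount p a (2 ^ i) ∧ 4 * windowCount p a (2 ^ i) ≤ 3 * 2 ^ i

theorem iff_zero_of_forall_iff_succ {p : ℕ → Prop} {n : ℕ} (h : ∀ x < n, (p x ↔ p (x + 1))) :
    ∀ x ≤ n, (p x ↔ p 0) := by
  intro x hx
  induction x with
  | zero => rfl
  | succ x ih => rw [← h x hx, ih (by omega)]

theorem IsBalanced.exists_ne_succ {p : ℕ → Prop} {a i : ℕ} (h : IsBalanced p a i) :
    ∃ y < 2 ^ i, ¬ (p (a + y) ↔ p (a + (y + 1))) := by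
  by_contra! hcon
  have hiff := iff_zero_of_forall_iff_succ (p := fun y => p (a + y)) hcon
  have hpos : 0 < 2 ^ i := by positivity
  obtain ⟨h1, h2⟩ := h
  have hnot := windowCount_not p a (2 ^ i)
  by_cases h0 : p (a + 0)
  · have : windowCount (fun x => ¬ p x) a (2 ^ i) = 0 := by
      refine windowCount_eq_zero fun y hy => ?_
      have := hiff y hy.le
      tauto
    omega
  · have : windowCount p a (2 ^ i) = 0 := by
      refine windowCount_eq_zero fun y hy => ?_
      have := hiff y hy.le
      tauto
    omega

/-- A balanced window contains a balanced window four times shorter: slide a short window along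
the long one. -/
theorem IsBalanced.exists_sub {p : ℕ → Prop} {a i : ℕ} (hi : 2 ≤ i) (h : IsBalanced p a (i + 2)) :
    ∃ b, a ≤ b ∧ b ≤ a + 3 * 2 ^ i ∧ IsBalanced p b i := by
  by_contra! hcon
  have h4 : 4 ≤ 2 ^ i := (by norm_num : 4 = 2 ^ 2).trans_le (Nat.pow_le_pow_right (by norm_num) hi)
  have hpow : 2 ^ (i + 2) = 4 * 2 ^ i := by ring
  rw [IsBalanced, hpow] at h
  simp only [IsBalanced] at hcon
  generalize 2 ^ i = n at *
  have hstep : ∀ t < 3 * n, (4 * windowCount p (a + t) n < n ↔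
      4 * windowCount p (a + (t + 1)) n < n) := by
    intro t ht
    have e1 := hcon (a + t) (by omega) (by omega)
    have e2 := hcon (a + (t + 1)) (by omega) (by omega)
    have c1 := count_add_windowCount p (a + t) n
    have c2 := count_add_windowCount p (a + (t + 1)) n
    have c3 := Nat.count_succ p (a + t)
    have c4 := Nat.count_succ p (a + t + n)
    rw [show a + (t + 1) + n = a + t + n + 1 by ring, show a + (t + 1) = a + t + 1 by ring] at *
    split_ifs at c3 c4 <;> omega
  have hiff := iff_zero_of_forall_iff_succ hstep
  have e0 := hcon (a + 0) (by omega) (by omega)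
  have e1 := hcon (a + n) (by omega) (by omega)
  have e2 := hcon (a + 2 * n) (by omega) (by omega)
  have e3 := hcon (a + 3 * n) (by omega) (by omega)
  have i1 := hiff n (by omega)
  have i2 := hiff (2 * n) (by omega)
  have i3 := hiff (3 * n) (by omega)
  have c0 := count_add_windowCount p a (4 * n)
  have c1 := count_add_windowCount p (a + 0) n
  have c2 := count_add_windowCount p (a + n) n
  have c3 := count_add_windowCount p (a + 2 * n) n
  have c4 := count_add_windowCount p (a + 3 * n) n
  rw [show a + n + n = a + 2 * n by ring] at c2
  rw [show a + 2 * n + n = a + 3 * n by ring] at c3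
  rw [show a + 3 * n + n = a + 4 * n by ring] at c4
  simp only [add_zero] at *
  omega

end Window

theorem Nat.pow_le_choose_mul (M k : ℕ) : M ^ k ≤ (M * k).choose k := by
  rcases M.eq_zero_or_pos with rfl | hM
  · cases k <;> simp
  induction k with
  | zero => simp
  | succ k ih =>
    have hpos : 0 < M * (k + 1) := by positivity
    have h1 := Nat.add_one_mul_choose_eq (M * (k + 1) - 1) k
    rw [Nat.sub_add_cancel hpos] at h1
    have h2 : (M * k).choose k ≤ (M * (k + 1) - 1).choose k :=
      Nat.choose_le_choose k (by rw [Nat.mul_succ]; omega)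
    refine Nat.le_of_mul_le_mul_right (c := k + 1) ?_ k.succ_pos
    rw [← h1]
    calc M ^ (k + 1) * (k + 1) = M * (k + 1) * M ^ k := by ring
      _ ≤ _ := Nat.mul_le_mul_left _ (ih.trans h2)

/-- A family of vertices `H l p` imitating the horocyclic grid of the hyperbolic plane: points at
height `l` in positions differing by at most `2 ^ (l + 1)` are joined by short paths through height
`l + 1`, while few of the points `H l (a + 2 ^ l * j)` coincide. -/
structure IsDyadicSystem {V : Type*} (G : SimpleGraph V) (H : ℕ → ℕ → V) (κ : ℕ) (γ : ℕ → ℕ) :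
    Prop where
  dist_up_le : ∀ {l p q : ℕ}, q ≤ p → p ≤ q + 2 ^ (l + 1) → G.dist (H l p) (H (l + 1) q) ≤ κ
  dist_succ_le : ∀ p : ℕ, G.dist (H 0 p) (H 0 (p + 1)) ≤ κ
  card_le : ∀ (l a d : ℕ) (t : V) (s : Finset ℕ), s ⊆ Finset.range (2 ^ d) →
    (∀ j ∈ s, H l (a + 2 ^ l * j) = t) → s.card ≤ γ d
  subexp : ∀ θ : ℝ, 1 < θ → ∃ C : ℝ, ∀ d, (γ d : ℝ) ≤ C * θ ^ d

namespace IsDyadicSystem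

open SimpleGraph

variable {V : Type*} {G : SimpleGraph V} {H : ℕ → ℕ → V} {κ : ℕ} {γ : ℕ → ℕ}

theorem card_le_of_dist_le [G.LocallyFinite] (hG : G.Connected) (hk : G.IsRegularOfDegree 3)
    (h : IsDyadicSystem G H κ γ) (l a d : ℕ) (u : V) (r : ℕ) (s : Finset ℕ)
    (hs : s ⊆ Finset.range (2 ^ d)) (hr : ∀ j ∈ s, G.dist (H l (a + 2 ^ l * j)) u ≤ r) :
    s.card ≤ γ d * 4 ^ r := by
  classical
  obtain ⟨b, hb, hmem⟩ := hG.exists_card_le_of_isRegularOfDegree hk u r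
  refine (Finset.card_le_mul_card_image_of_maps_to (t := b)
    (fun j hj => hmem _ (hr j hj)) (γ d) fun t _ => ?_).trans (Nat.mul_le_mul_left _ hb)
  exact h.card_le l a d t _ ((Finset.filter_subset _ _).trans hs) fun j hj =>
    (Finset.mem_filter.1 hj).2

theorem exists_tail_lt (h : IsDyadicSystem G H κ γ) (B : ℕ) :
    ∃ W, ∀ i, 4 * ∑ d ∈ Finset.Ico W (i + 1), 2 ^ (i - d) * (γ d * B) < 2 ^ i := by
  obtain ⟨C, hC⟩ := h.subexp (3 / 2) (by norm_num)
  have hsum : Summable fun d : ℕ => (γ d * B : ℝ) / 2 ^ d := by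
    refine Summable.of_nonneg_of_le (fun d => by positivity) (fun d => ?_)
      ((summable_geometric_of_lt_one (r := 3 / 4) (by norm_num) (by norm_num)).mul_left (C * B))
    calc (γ d * B : ℝ) / 2 ^ d ≤ (C * (3 / 2) ^ d) * B / 2 ^ d := by gcongr; exact hC d
      _ = C * B * (3 / 4) ^ d := by
        rw [show (3 / 4 : ℝ) = (3 / 2) / 2 by norm_num, div_pow (3 / 2 : ℝ) 2 d]
        ring
  obtain ⟨s, hs⟩ := summable_iff_vanishing_norm.1 hsum (1 / 4) (by norm_num)
  refine ⟨s.sup id + 1, fun i => ?_⟩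
  have hdis : Disjoint (Finset.Ico (s.sup id + 1) (i + 1)) s := by
    rw [Finset.disjoint_left]
    intro x hx hxs
    have : x ≤ s.sup id := Finset.le_sup (f := id) hxs
    rw [Finset.mem_Ico] at hx
    omega
  have hlt := (le_abs_self _).trans_lt (hs _ hdis)
  have h2 : (0 : ℝ) < 2 ^ i := by positivity
  have heq : ((∑ d ∈ Finset.Ico (s.sup id + 1) (i + 1), 2 ^ (i - d) * (γ d * B) : ℕ) : ℝ) =
      2 ^ i * ∑ d ∈ Finset.Ico (s.sup id + 1) (i + 1), (γ d * B : ℝ) / 2 ^ d := by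
    push_cast
    rw [Finset.mul_sum]
    refine Finset.sum_congr rfl fun d hd => ?_
    rw [pow_sub₀ _ two_ne_zero (by rw [Finset.mem_Ico] at hd; omega)]
    field_simp
  have : (4 : ℝ) * ((∑ d ∈ Finset.Ico (s.sup id + 1) (i + 1), 2 ^ (i - d) * (γ d * B) : ℕ) : ℝ)
      < 2 ^ i := by
    rw [heq]
    nlinarith
  exact_mod_cast this

theorem exists_four_mul_lt (h : IsDyadicSystem G H κ γ) : ∃ ℓ, ∀ i, ℓ ≤ i → 4 * γ i < 2 ^ i := by
  obtain ⟨W, hW⟩ := h.exists_tail_lt 1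
  refine ⟨W, fun i hi => (Nat.mul_le_mul_left 4 ?_).trans_lt (hW i)⟩
  have := Finset.single_le_sum (f := fun d => 2 ^ (i - d) * (γ d * 1))
    (fun _ _ => Nat.zero_le _) (Finset.mem_Ico.2 ⟨hi, i.lt_succ_self⟩)
  simpa using this

theorem dist_ancestor_succ_le (h : IsDyadicSystem G H κ γ) (a y l : ℕ) :
    G.dist (H l (a + 2 ^ l * (y / 2 ^ l))) (H (l + 1) (a + 2 ^ (l + 1) * (y / 2 ^ (l + 1)))) ≤
      κ := by
  have hl := Nat.div_add_mod y (2 ^ l)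
  have hl' := Nat.div_add_mod y (2 ^ (l + 1))
  have hr := Nat.mod_lt y (y := 2 ^ (l + 1)) (by positivity)
  refine h.dist_up_le ?_ ?_
  · refine Nat.add_le_add_left ?_ a
    rw [pow_succ, mul_assoc, ← Nat.div_div_eq_div_mul]
    exact Nat.mul_le_mul_left _ (Nat.mul_div_le _ _)
  · omega

theorem dist_ancestor_le (h : IsDyadicSystem G H κ γ) (hG : G.Connected) (a y : ℕ) {l i : ℕ}
    (hl : l ≤ i) :
    G.dist (H l (a + 2 ^ l * (y / 2 ^ l))) (H i (a + 2 ^ i * (y / 2 ^ i))) ≤ κ * (i - l) := by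
  induction i, hl using Nat.le_induction with
  | base => simp
  | succ i hl ih =>
    refine hG.dist_triangle.trans ((add_le_add ih (h.dist_ancestor_succ_le a y i)).trans ?_)
    rw [Nat.succ_sub hl, Nat.mul_succ]

/-- If the top vertex `H i a` is far from an edge of the tree, most of the vertices below it are on
the same side of that edge. -/
theorem exists_minority_lt [G.LocallyFinite] (hG : G.Connected) (hA : G.IsAcyclic)
    (hk : G.IsRegularOfDegree 3) (h : IsDyadicSystem G H κ γ) :
    ∃ m, ∀ u w, G.Adj u w → ∀ i a, m < G.dist (H i a) u →
      4 * windowCount (fun x => ¬ (H 0 x ∈ G.nearSide u w ↔ H i a ∈ G.nearSide u w)) a (2 ^ i)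
        < 2 ^ i := by
  classical
  obtain ⟨W, hW⟩ := h.exists_tail_lt (4 ^ κ)
  refine ⟨κ * W, fun u w huw i a hm => (Nat.mul_le_mul_left 4 ?_).trans_lt (hW i)⟩
  let N : ℕ → ℕ → V := fun y l => H l (a + 2 ^ l * (y / 2 ^ l))
  let bad : ℕ → Finset ℕ := fun d => (Finset.range (2 ^ i)).filter fun y =>
    G.dist (N y (i - d)) u ≤ κ
  have hbad : ∀ d ∈ Finset.Ico W (i + 1), (bad d).card ≤ 2 ^ (i - d) * (γ d * 4 ^ κ) := by
    intro d hd
    rw [Finset.mem_Ico] at hd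
    refine (Finset.card_le_mul_card_image (f := fun y => y / 2 ^ (i - d)) (bad d) (2 ^ (i - d))
      fun b _ => ?_).trans (Nat.mul_le_mul_left _ ?_)
    · have hsub : (bad d).filter (fun y => y / 2 ^ (i - d) = b) ⊆
          Finset.Ico (2 ^ (i - d) * b) (2 ^ (i - d) * b + 2 ^ (i - d)) := by
        intro y hy
        have h1 := Nat.div_add_mod y (2 ^ (i - d))
        have h2 := Nat.mod_lt y (y := 2 ^ (i - d)) (by positivity)
        rw [(Finset.mem_filter.1 hy).2] at h1
        rw [Finset.mem_Ico]
        omega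
      simpa using Finset.card_le_card hsub
    · refine h.card_le_of_dist_le hG hk (i - d) a d u κ _ ?_ ?_
      · intro j hj
        obtain ⟨y, hy, rfl⟩ := Finset.mem_image.1 hj
        have hy' := Finset.mem_range.1 (Finset.mem_filter.1 hy).1
        rw [Finset.mem_range, Nat.div_lt_iff_lt_mul (by positivity), ← pow_add]
        rwa [show d + (i - d) = i by omega]
      · intro j hj
        obtain ⟨y, hy, rfl⟩ := Finset.mem_image.1 hj
        exact (Finset.mem_filter.1 hy).2
  refine windowCount_le_of_forall fun s hs hne => le_trans (Finset.card_le_card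
    (t := (Finset.Ico W (i + 1)).biUnion bad) fun y hy => ?_)
    (Finset.card_biUnion_le.trans (Finset.sum_le_sum hbad))
  have hyi' := Finset.mem_range.1 (hs hy)
  have h0 : N y 0 = H 0 (a + y) := by simp [N]
  have hi : N y i = H i a := by simp [N, Nat.div_eq_of_lt hyi']
  obtain ⟨l, hl, hcross⟩ : ∃ l < i, ¬ (N y l ∈ G.nearSide u w ↔ N y (l + 1) ∈ G.nearSide u w) := by
    by_contra! hcon
    have := iff_zero_of_forall_iff_succ hcon i le_rfl
    rw [h0, hi] at this
    exact hne y hy this.symm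
  have hdist : G.dist (N y l) (N y (l + 1)) ≤ κ := h.dist_ancestor_succ_le a y l
  have hlu : G.dist (N y l) u ≤ κ :=
    (Nat.le_add_right _ _).trans
      ((hA.dist_le_of_not_mem_nearSide_iff hG huw hcross).trans hdist)
  have htop : G.dist (N y l) (N y i) ≤ κ * (i - l) := h.dist_ancestor_le hG a y hl.le
  have hWl : W ≤ i - l := by
    have h1 := hG.dist_triangle (u := H i a) (v := N y l) (w := u)
    rw [← hi, dist_comm (u := N y i) (v := N y l)] at h1
    rw [← hi] at hm
    have h2 : κ * W < κ * (i - l + 1) := by rw [Nat.mul_succ]; omega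
    have := lt_of_mul_lt_mul_left h2 (Nat.zero_le _)
    omega
  refine Finset.mem_biUnion.2 ⟨i - l, Finset.mem_Ico.2 ⟨hWl, by omega⟩,
    Finset.mem_filter.2 ⟨hs hy, ?_⟩⟩
  rwa [Nat.sub_sub_self hl.le]

theorem exists_dist_le_of_isBalanced [G.LocallyFinite] (hG : G.Connected) (hA : G.IsAcyclic)
    (hk : G.IsRegularOfDegree 3) (h : IsDyadicSystem G H κ γ) :
    ∃ m, ∀ u w, G.Adj u w → ∀ i a, IsBalanced (fun x => H 0 x ∈ G.nearSide u w) a i →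
      G.dist (H i a) u ≤ m := by
  obtain ⟨m, hm⟩ := h.exists_minority_lt hG hA hk
  refine ⟨m, fun u w huw i a hbal => not_lt.1 fun hlt => ?_⟩
  have h1 := hm u w huw i a hlt
  have h2 := windowCount_not (fun x => H 0 x ∈ G.nearSide u w) a (2 ^ i)
  obtain ⟨h3, h4⟩ := hbal
  by_cases hmem : H i a ∈ G.nearSide u w <;> simp only [hmem, iff_true, iff_false, not_not] at h1 <;>
    omega

theorem exists_isBalanced [G.LocallyFinite] (hG : G.Connected) (hk : G.IsRegularOfDegree 3)
    (h : IsDyadicSystem G H κ γ) {i : ℕ} (hi : 4 * γ i < 2 ^ i) (a : ℕ) :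
    ∃ u w, G.Adj u w ∧ IsBalanced (fun x => H 0 x ∈ G.nearSide u w) a i := by
  classical
  obtain ⟨u, w, huw, h1, h2⟩ :=
    hG.exists_balanced_edge hk (Finset.range (2 ^ i)) (fun y => H 0 (a + y))
  have h3 := h.card_le 0 a i u ((Finset.range (2 ^ i)).filter fun y => H 0 (a + y) = u)
    (Finset.filter_subset _ _) (by simp)
  have h4 : ((Finset.range (2 ^ i)).filter fun y => H 0 (a + y) ∈ G.nearSide u w).card =
      windowCount (fun x => H 0 x ∈ G.nearSide u w) a (2 ^ i) := by
    unfold windowCount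
    congr
  rw [Finset.card_range] at h1 h2
  refine ⟨u, w, huw, ?_, ?_⟩ <;> rw [← h4]
  · have : 2 ^ i ≤ γ i + 3 * _ := h2.trans (Nat.add_le_add_right (by convert h3) _)
    omega
  · omega

theorem one_le_windowCount (h : IsDyadicSystem G H κ γ) (hG : G.Connected) (hA : G.IsAcyclic)
    {u w : V} (huw : G.Adj u w) {a i : ℕ}
    (hbal : IsBalanced (fun x => H 0 x ∈ G.nearSide u w) a i) {r : ℕ} (hr : κ ≤ r) :
    1 ≤ windowCount (fun x => G.dist (H 0 x) u ≤ r) a (2 ^ i) := by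
  obtain ⟨y, hy, hne⟩ := hbal.exists_ne_succ
  refine windowCount_pos hy (le_trans ?_ hr)
  have hdist : G.dist (H 0 (a + y)) (H 0 (a + (y + 1))) ≤ κ := h.dist_succ_le (a + y)
  have := hA.dist_le_of_not_mem_nearSide_iff hG huw hne
  omega

/-- The number of points of a balanced window close to the balancing edge grows like a binomial
coefficient: besides a shorter balanced window for the same edge, the window contains a disjoint
one balanced for a nearby edge. -/
theorem exists_choose_le_windowCount [G.LocallyFinite] (hG : G.Connected) (hA : G.IsAcyclic)
    (hk : G.IsRegularOfDegree 3) (h : IsDyadicSystem G H κ γ) :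
    ∃ ℓ c, (∀ i, ℓ ≤ i → 4 * γ i < 2 ^ i) ∧ ∀ s k u w a, G.Adj u w →
      IsBalanced (fun x => H 0 x ∈ G.nearSide u w) a (ℓ + 2 * s) →
        s.choose k ≤ windowCount (fun x => G.dist (H 0 x) u ≤ k * c + κ) a (2 ^ (ℓ + 2 * s)) := by
  obtain ⟨ℓ, hℓ⟩ := h.exists_four_mul_lt
  obtain ⟨m, hm⟩ := h.exists_dist_le_of_isBalanced hG hA hk
  refine ⟨ℓ + 2, 2 * m + 2 * κ, fun i hi => hℓ i (by omega), fun s => ?_⟩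
  induction s with
  | zero =>
    intro k u w a huw hbal
    refine le_trans ?_ (h.one_le_windowCount hG hA huw hbal (Nat.le_add_left _ _))
    cases k <;> simp
  | succ s ih =>
    rintro (_ | k) u w a huw hbal
    · simpa using h.one_le_windowCount hG hA huw hbal (Nat.le_add_left κ (0 * (2 * m + 2 * κ)))
    set i := ℓ + 2 + 2 * s with hi
    rw [show ℓ + 2 + 2 * (s + 1) = i + 2 by omega] at hbal ⊢
    obtain ⟨b, hab, hba, hb⟩ := hbal.exists_sub (by omega)
    have hpow : 2 ^ (i + 2) = 4 * 2 ^ i := by ring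
    have hpow1 : 2 ^ (i + 1) = 2 * 2 ^ i := by ring
    obtain ⟨c, hc, hac⟩ : ∃ c, (c = a ∨ c = a + 2 ^ (i + 1)) ∧
        (c + 2 ^ i ≤ b ∨ b + 2 ^ i ≤ c) := by
      by_cases hle : a + 2 ^ i ≤ b
      · exact ⟨a, Or.inl rfl, Or.inl hle⟩
      · exact ⟨a + 2 ^ (i + 1), Or.inr rfl, Or.inr (by omega)⟩
    obtain ⟨u', w', huw', hc'⟩ := h.exists_isBalanced hG hk (hℓ i (by omega)) c
    have h1 := ih (k + 1) u w b huw hb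
    have h2 := ih k u' w' c huw' hc'
    have hdist : G.dist u' u ≤ 2 * m + 2 * κ := by
      have d1 := hm u w huw _ _ hbal
      have d2 := hm u' w' huw' _ _ hc'
      have d3 : G.dist (H i c) (H (i + 1) c) ≤ κ := h.dist_up_le le_rfl (by omega)
      have d4 : G.dist (H (i + 1) c) (H (i + 2) a) ≤ κ := h.dist_up_le (by omega) (by
        rw [show i + 1 + 1 = i + 2 by rfl]; omega)
      rw [dist_comm] at d2
      have e1 := hG.dist_triangle (u := u') (v := H i c) (w := u)
      have e2 := hG.dist_triangle (u := H i c) (v := H (i + 1) c) (w := u)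
      have e3 := hG.dist_triangle (u := H (i + 1) c) (v := H (i + 2) a) (w := u)
      omega
    have h3 : windowCount (fun x => G.dist (H 0 x) u' ≤ k * (2 * m + 2 * κ) + κ) c (2 ^ i) ≤
        windowCount (fun x => G.dist (H 0 x) u ≤ (k + 1) * (2 * m + 2 * κ) + κ) c (2 ^ i) := by
      refine windowCount_mono (fun x hx => ?_) _ _
      have := hG.dist_triangle (u := H 0 x) (v := u') (w := u)
      rw [Nat.succ_mul]
      omega
    rw [Nat.choose_succ_succ]
    refine (add_le_add (h2.trans h3) h1).trans ?_
    rcases hac with hle | hle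
    · exact windowCount_add_le_of_disjoint _ (by omega) hle (by omega)
    · rw [add_comm]
      exact windowCount_add_le_of_disjoint _ hab hle (by omega)

/-- No dyadic system lives in a regular tree of degree three. -/
theorem false [G.LocallyFinite] (hG : G.Connected) (hA : G.IsAcyclic)
    (hk : G.IsRegularOfDegree 3) (h : IsDyadicSystem G H κ γ) : False := by
  obtain ⟨ℓ, c, hℓ, hchoose⟩ := h.exists_choose_le_windowCount hG hA hk
  set M := 2 * 4 ^ c with hM
  have hMpos : 0 < M := by positivity
  have hmain : ∀ k, 2 ^ k ≤ 4 ^ κ * γ (ℓ + 2 * (M * k)) := by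
    intro k
    obtain ⟨u, w, huw, hbal⟩ := h.exists_isBalanced hG hk (hℓ (ℓ + 2 * (M * k)) (by omega)) 0
    have h1 := (Nat.pow_le_choose_mul M k).trans (hchoose (M * k) k u w 0 huw hbal)
    have h2 : windowCount (fun x => G.dist (H 0 x) u ≤ k * c + κ) 0 (2 ^ (ℓ + 2 * (M * k))) ≤
        γ (ℓ + 2 * (M * k)) * 4 ^ (k * c + κ) :=
      windowCount_le_of_forall fun s hs hr =>
        h.card_le_of_dist_le hG hk 0 0 _ u _ s hs (by simpa using hr)
    have h3 := h1.trans h2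
    rw [hM, mul_pow, ← pow_mul, pow_add, mul_comm c k] at h3
    refine Nat.le_of_mul_le_mul_right (c := 4 ^ (k * c)) (h3.trans_eq (by ring)) (by positivity)
  have h2M : 2 * M ≠ 0 := by positivity
  obtain ⟨θ, hθ, hθM⟩ : ∃ θ : ℝ, 1 < θ ∧ θ ^ (2 * M) = 3 / 2 := by
    refine ⟨(3 / 2) ^ (((2 * M : ℕ) : ℝ)⁻¹), Real.one_lt_rpow (by norm_num) (by positivity), ?_⟩
    exact Real.rpow_inv_natCast_pow (by norm_num) h2M
  obtain ⟨C, hC⟩ := h.subexp θ hθ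
  obtain ⟨k, hlt⟩ := pow_unbounded_of_one_lt (4 ^ κ * (C * θ ^ ℓ)) (by norm_num : (1 : ℝ) < 4 / 3)
  have h1 : (2 : ℝ) ^ k ≤ 4 ^ κ * (C * θ ^ (ℓ + 2 * (M * k))) :=
    calc (2 : ℝ) ^ k ≤ 4 ^ κ * γ (ℓ + 2 * (M * k)) := by exact_mod_cast hmain k
      _ ≤ _ := by gcongr; exact hC _
  rw [← mul_assoc 2, pow_add, ← mul_assoc, ← mul_assoc, pow_mul θ, hθM] at h1
  have h2 : (4 / 3 : ℝ) ^ k * (3 / 2) ^ k = 2 ^ k := by rw [← mul_pow]; norm_num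
  have h3 : (0 : ℝ) < (3 / 2) ^ k := by positivity
  nlinarith

end IsDyadicSystem

theorem SubexpFun.exists_le_mul_exp {g : ℝ → ℝ} (hg : SubexpFun g) {ε : ℝ} (hε : 0 < ε) :
    ∃ C, ∀ r, 0 ≤ r → g r ≤ C * Real.exp (ε * r) := by
  obtain ⟨hmono, hnonneg, hlim⟩ := hg
  obtain ⟨R, hR⟩ := Filter.eventually_atTop.1 (hlim.eventually (gt_mem_nhds hε))
  refine ⟨1 + g (max R 1), fun r hr => ?_⟩
  have hexp : 1 ≤ Real.exp (ε * r) := Real.one_le_exp (by positivity)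
  have hmax := hnonneg (max R 1)
  rcases le_total r (max R 1) with hle | hle
  · have := hmono hr (hr.trans hle) hle
    nlinarith
  · have hr1 : 0 < r := zero_lt_one.trans_le ((le_max_right _ _).trans hle)
    have hlog := (div_lt_iff₀ hr1).1 (hR r ((le_max_left _ _).trans hle))
    have : g r ≤ Real.exp (ε * r) := by
      rcases (hnonneg r).eq_or_lt with h0 | h0
      · rw [← h0]
        positivity
      · exact (Real.log_le_iff_le_exp h0).1 hlog.le
    nlinarith

namespace UpperHalfPlane

/-- The point of the upper half-plane over `p` at height `η * 2 ^ l`. -/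
noncomputable def gridPoint {η : ℝ} (hη : 0 < η) (l p : ℕ) : UpperHalfPlane :=
  ⟨⟨p, η * 2 ^ l⟩, by positivity⟩

variable {η : ℝ} (hη : 0 < η)

@[simp] theorem gridPoint_re (l p : ℕ) : (gridPoint hη l p).re = p := rfl

@[simp] theorem gridPoint_im (l p : ℕ) : (gridPoint hη l p).im = η * 2 ^ l := rfl

theorem dist_gridPoint_add (l n p : ℕ) :
    dist (gridPoint hη l p) (gridPoint hη (l + n) p) = n * Real.log 2 := by
  rw [dist_of_re_eq (by simp), gridPoint_im, gridPoint_im, pow_add, ← mul_assoc,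
    Real.log_mul (x := η * 2 ^ l) (by positivity) (by positivity), Real.log_pow, dist_self_add_right,
    Real.norm_of_nonneg (by have := Real.log_nonneg one_le_two; positivity)]

theorem dist_coe_gridPoint (l p q : ℕ) :
    dist (gridPoint hη l p : ℂ) (gridPoint hη l q) = |(p : ℝ) - q| := by
  rw [Complex.dist_of_im_eq (by simp)]
  rfl

theorem sqrt_im_gridPoint (l p q : ℕ) :
    √((gridPoint hη l p).im * (gridPoint hη l q).im) = η * 2 ^ l := by
  rw [gridPoint_im, gridPoint_im, Real.sqrt_mul_self (by positivity)]

theorem dist_gridPoint_le {l p q : ℕ} (h : |(p : ℝ) - q| ≤ 2 ^ l) :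
    dist (gridPoint hη l p) (gridPoint hη l q) ≤ 1 / η := by
  refine (dist_le_dist_coe_div_sqrt _ _).trans ?_
  rw [dist_coe_gridPoint, sqrt_im_gridPoint, div_le_div_iff₀ (by positivity) hη]
  nlinarith

theorem dist_gridPoint_le_add {l n p q : ℕ} (h : |(p : ℝ) - q| ≤ 2 ^ (l + n)) :
    dist (gridPoint hη l p) (gridPoint hη l q) ≤ 2 * (n * Real.log 2) + 1 / η := by
  have h1 := dist_triangle4 (gridPoint hη l p) (gridPoint hη (l + n) p) (gridPoint hη (l + n) q)
    (gridPoint hη l q)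
  rw [dist_gridPoint_add, dist_comm (gridPoint hη (l + n) q), dist_gridPoint_add] at h1
  linarith [dist_gridPoint_le hη h]

theorem le_sinh_half_dist_gridPoint {l p q : ℕ} (h : 2 ^ l ≤ |(p : ℝ) - q|) :
    1 / (2 * η) ≤ Real.sinh (dist (gridPoint hη l p) (gridPoint hη l q) / 2) := by
  rw [sinh_half_dist, dist_coe_gridPoint, sqrt_im_gridPoint,
    div_le_div_iff₀ (by positivity) (by positivity)]
  nlinarith

end UpperHalfPlane

open UpperHalfPlane in
/-- A quasi-isometric embedding of the hyperbolic plane into the product of a tree and a space of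
subexponential growth projects to a dyadic system in the tree. -/
theorem exists_isDyadicSystem_of_isQIEmbedding {T Z P : Type*} [MetricSpace T] [MetricSpace Z]
    [MetricSpace P] (G : SimpleGraph T) (hG : ∀ u v : T, dist u v = (G.dist u v : ℝ))
    (hZ : HasSubexpGrowth Z) (e : P ≃ T × Z)
    (hP : ∀ p q : P, dist p q = dist (e p).1 (e q).1 + dist (e p).2 (e q).2)
    {f : UpperHalfPlane → P} (hf : IsQIEmbedding f) : ∃ H κ γ, IsDyadicSystem G H κ γ := by
  classical
  obtain ⟨L, D, hL, hD, hf⟩ := hf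
  obtain ⟨g, hg, hgZ⟩ := hZ
  have hlog : 0 < Real.log 2 := Real.log_pos one_lt_two
  have hsinh : 0 ≤ Real.sinh (L * D / 2) := Real.sinh_nonneg_iff.2 (by positivity)
  obtain ⟨η, hη, hηL⟩ : ∃ η : ℝ, 0 < η ∧ Real.sinh (L * D / 2) < 1 / (2 * η) := by
    refine ⟨1 / (2 * (Real.sinh (L * D / 2) + 1)), by positivity, ?_⟩
    field_simp
    linarith
  have hT : ∀ x y, (G.dist (e (f x)).1 (e (f y)).1 : ℝ) ≤ L * dist x y + D := fun x y => by
    have := (hf x y).2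
    rw [hP] at this
    rw [← hG]
    linarith [dist_nonneg (x := (e (f x)).2) (y := (e (f y)).2)]
  set ρ : ℕ → ℝ := fun d => L * (2 * (d * Real.log 2) + 1 / η) + D with hρ
  have hρ0 : ∀ d, 0 ≤ ρ d := fun d => by positivity
  refine ⟨fun l p => (e (f (gridPoint hη l p))).1, ⌈L * (Real.log 2 + 1 / η) + D⌉₊,
    fun d => ⌊g (ρ d)⌋₊, ?_, ?_, ?_, ?_⟩
  · intro l p q hqp hpq
    have h1 := dist_triangle (gridPoint hη l p) (gridPoint hη (l + 1) p) (gridPoint hη (l + 1) q)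
    have h2 : |(p : ℝ) - q| ≤ 2 ^ (l + 1) := by
      have h3 : (q : ℝ) ≤ p := by exact_mod_cast hqp
      have h4 : (p : ℝ) ≤ q + 2 ^ (l + 1) := by exact_mod_cast hpq
      rw [abs_le]
      constructor <;> linarith
    rw [dist_gridPoint_add, Nat.cast_one, one_mul] at h1
    have h5 := h1.trans (add_le_add_right (dist_gridPoint_le hη h2) _)
    refine Nat.cast_le.1 ((hT _ _).trans (le_trans ?_ (Nat.le_ceil _)))
    gcongr
  · intro p
    have h1 : dist (gridPoint hη 0 p) (gridPoint hη 0 (p + 1)) ≤ 1 / η :=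
      dist_gridPoint_le hη (by simp)
    refine Nat.cast_le.1 ((hT _ _).trans (le_trans ?_ (Nat.le_ceil _)))
    gcongr
    linarith
  · intro l a d t s hs ht
    rcases s.eq_empty_or_nonempty with rfl | ⟨j₀, hj₀⟩
    · simp
    have hdiff : ∀ i j : ℕ, ((a + 2 ^ l * i : ℕ) : ℝ) - (a + 2 ^ l * j : ℕ) =
        2 ^ l * ((i : ℝ) - j) := fun i j => by push_cast; ring
    have hPs : ∀ i ∈ s, ∀ j ∈ s, dist (f (gridPoint hη l (a + 2 ^ l * i)))
        (f (gridPoint hη l (a + 2 ^ l * j))) = dist (e (f (gridPoint hη l (a + 2 ^ l * i)))).2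
          (e (f (gridPoint hη l (a + 2 ^ l * j)))).2 := fun i hi j hj => by
      rw [hP, ht i hi, ht j hj, dist_self, zero_add]
    have hinj : Set.InjOn (fun j => (e (f (gridPoint hη l (a + 2 ^ l * j)))).2) s := by
      intro i hi j hj hij
      by_contra hne
      have h1 := hPs i hi j hj
      rw [show (e (f (gridPoint hη l (a + 2 ^ l * i)))).2 = _ from hij, dist_self] at h1
      have h2 := (hf (gridPoint hη l (a + 2 ^ l * i)) (gridPoint hη l (a + 2 ^ l * j))).1
      rw [h1, sub_nonpos, inv_mul_le_iff₀ (by positivity)] at h2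
      have h3 : (1 : ℝ) ≤ |(i : ℝ) - j| := by
        have : (1 : ℤ) ≤ |(i : ℤ) - j| := Int.one_le_abs (by omega)
        exact_mod_cast this
      have h4 := le_sinh_half_dist_gridPoint hη (l := l) (p := a + 2 ^ l * i)
        (q := a + 2 ^ l * j) (by
          rw [hdiff, abs_mul, abs_of_pos (by positivity : (0 : ℝ) < 2 ^ l)]
          exact le_mul_of_one_le_right (by positivity) h3)
      have h5 := Real.sinh_le_sinh.2 (div_le_div_of_nonneg_right h2 zero_le_two)
      linarith
    rw [← Finset.card_image_of_injOn hinj]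
    refine Nat.le_floor (hgZ (e (f (gridPoint hη l (a + 2 ^ l * j₀)))).2 (ρ d) (hρ0 d) _ ?_)
    intro z hz
    obtain ⟨j, hj, rfl⟩ := Finset.mem_image.1 hz
    rw [Metric.mem_closedBall, ← hPs j hj j₀ hj₀]
    refine (hf _ _).2.trans ?_
    have hj' : (j : ℝ) < 2 ^ d := by exact_mod_cast Finset.mem_range.1 (hs hj)
    have hj₀' : (j₀ : ℝ) < 2 ^ d := by exact_mod_cast Finset.mem_range.1 (hs hj₀)
    have hle : |(j : ℝ) - j₀| ≤ 2 ^ d := by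
      rw [abs_le]
      constructor <;> linarith [Nat.cast_nonneg (α := ℝ) j, Nat.cast_nonneg (α := ℝ) j₀]
    have := dist_gridPoint_le_add hη (l := l) (n := d) (p := a + 2 ^ l * j)
      (q := a + 2 ^ l * j₀) (by
        rw [hdiff, abs_mul, abs_of_pos (by positivity : (0 : ℝ) < 2 ^ l), pow_add]
        gcongr)
    simp only [hρ]
    gcongr
  · intro θ hθ
    have hθlog := Real.log_pos hθ
    obtain ⟨C, hC⟩ := hg.exists_le_mul_exp (ε := Real.log θ / (2 * L * Real.log 2)) (by positivity)
    refine ⟨C * Real.exp (Real.log θ / (2 * L * Real.log 2) * (L * (1 / η) + D)), fun d => ?_⟩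
    refine (Nat.floor_le (hg.2.1 _)).trans ((hC _ (hρ0 d)).trans_eq ?_)
    have : θ ^ d = Real.exp (d * Real.log θ) := by
      rw [Real.exp_nat_mul, Real.exp_log (by positivity)]
    rw [this, mul_assoc C, ← Real.exp_add]
    congr 2
    simp only [hρ]
    field_simp
    ring

/-- There is no quasi-isometric embedding from the hyperbolic plane `ℍ²`
to `T₃ × Z`, where `T₃` is the 3-regular tree and `Z` is a connected bounded degree graph of
subexponential growth, with the ℓ¹ product metric on `T₃ × Z`. -/
theorem no_qi_embedding_H2_to_T3_times_subexponential
    (T Z P : Type*) [MetricSpace T] [MetricSpace Z] [MetricSpace P]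
    (hT : IsCubicTreeMetric T)
    (hZ : IsBddDegGraphMetric Z) (hZgrowth : HasSubexpGrowth Z)
    (e : P ≃ T × Z)
    (hP : ∀ p q : P, dist p q = dist (e p).1 (e q).1 + dist (e p).2 (e q).2) :
    ¬ ∃ f : UpperHalfPlane → P, IsQIEmbedding f := by
  rintro ⟨f, hf⟩
  obtain ⟨G, hG, hA, hcard, hdist⟩ := hT
  have : G.LocallyFinite := fun v =>
    (Set.finite_of_ncard_ne_zero (s := G.neighborSet v) (by simp [hcard v])).fintype
  have hk : G.IsRegularOfDegree 3 := fun v => by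
    rw [← SimpleGraph.card_neighborSet_eq_degree, ← Nat.card_eq_fintype_card]
    exact hcard v
  obtain ⟨H, κ, γ, h⟩ := exists_isDyadicSystem_of_isQIEmbedding G hdist hZgrowth e hP hf
  exact h.false hG hA hk
end

section
/- For every n ≥ 2 there is no regular map from (T₃)ⁿ (the ℓ¹ product of n copies of the 3-regular tree) to (ℍ²)^{n−1} × Z (the ℓ¹ product of n−1 copies of the hyperbolic plane with Z), whenever Z is the vertex set of a connected simple graph of uniformly bounded degree of subexponential growth (i.e. there is a non-decreasing function g with (1/r)·log g(r) → 0 as r → ∞ such that every ball of radius r in Z contains at most g(r) vertices). -/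
open Metric Set

section PoincareMiranda

variable {ι : Type*} [DecidableEq ι]

/-- The cup product of the coboundaries of the mod 2 cochains `c j`, `j ∈ l`, on the cube based at
`t` with directions `A`. -/
def cupCoboundary (c : ι → (ι → ℕ) → ZMod 2) : List ι → Finset ι → (ι → ℕ) → ZMod 2
  | [], _, _ => 1
  | j :: l, A, t => ∑ a ∈ A, (c j (t + Pi.single a 1) - c j t) *
      cupCoboundary c l (A.erase a) (t + Pi.single a 1)

theorem sum_sum_erase_symm {M : Type*} [AddCommMonoid M] (A : Finset ι) (F : ι → ι → M) :
    ∑ a ∈ A, ∑ b ∈ A.erase a, F a b = ∑ b ∈ A, ∑ a ∈ A.erase b, F a b := by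
  apply Finset.sum_comm'
  intro x y
  simp only [Finset.mem_erase]
  tauto

theorem cupCoboundary_closed (c : ι → (ι → ℕ) → ZMod 2) (l : List ι) (A : Finset ι) (t : ι → ℕ) :
    ∑ a ∈ A, (cupCoboundary c l (A.erase a) (t + Pi.single a 1) -
      cupCoboundary c l (A.erase a) t) = 0 := by
  induction l generalizing A t with
  | nil => simp [cupCoboundary]
  | cons j l ih =>
    have two : (2 : ZMod 2) = 0 := rfl
    let γ : ι → ι → ZMod 2 := fun a b =>
      cupCoboundary c l ((A.erase a).erase b) (t + Pi.single a 1 + Pi.single b 1)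
    have γsymm : ∀ a b, γ a b = γ b a := by
      intro a b
      simp only [γ, Finset.erase_right_comm (a := a) (b := b), add_right_comm t]
    -- the square identity, valid mod 2
    have key : ∑ a ∈ A, ∑ b ∈ A.erase a,
          (c j (t + Pi.single a 1 + Pi.single b 1) - c j (t + Pi.single a 1)) * γ a b =
        ∑ a ∈ A, ∑ b ∈ A.erase a, (c j (t + Pi.single b 1) - c j t) * γ a b := by
      have h1 : ∑ a ∈ A, ∑ b ∈ A.erase a,
            (c j (t + Pi.single a 1 + Pi.single b 1) - c j t) * γ a b = 0 := by
        have inv : ∀ F : ι → ι → ZMod 2, (∀ a b, F a b = F b a) →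
            ∑ a ∈ A, ∑ b ∈ A.erase a, F a b = 0 := by
          intro F hF
          rw [Finset.sum_sigma']
          refine Finset.sum_involution (fun x _ => ⟨x.2, x.1⟩) ?_ ?_ ?_ ?_
          · rintro ⟨a, b⟩ _
            simp only
            rw [hF b a, ← two_mul, two, zero_mul]
          · rintro ⟨a, b⟩ h _ h'
            simp only [Finset.mem_sigma, Finset.mem_erase] at h
            simp only [Sigma.mk.injEq] at h'
            exact h.2.1 h'.1
          · rintro ⟨a, b⟩ h
            simp only [Finset.mem_sigma, Finset.mem_erase] at h ⊢
            exact ⟨h.2.2, h.2.1.symm, h.1⟩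
          · rintro ⟨a, b⟩ _
            rfl
        apply inv
        intro a b
        rw [γsymm a b, add_right_comm t]
      have h2 : ∑ a ∈ A, ∑ b ∈ A.erase a, (c j (t + Pi.single a 1) - c j t) * γ a b =
          ∑ a ∈ A, ∑ b ∈ A.erase a, (c j (t + Pi.single b 1) - c j t) * γ a b := by
        rw [sum_sum_erase_symm]
        refine Finset.sum_congr rfl fun a _ => Finset.sum_congr rfl fun b _ => ?_
        rw [γsymm]
      rw [← h2, ← sub_eq_zero, ← Finset.sum_sub_distrib]
      rw [← h1]
      refine Finset.sum_congr rfl fun a _ => ?_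
      rw [← Finset.sum_sub_distrib]
      refine Finset.sum_congr rfl fun b _ => ?_
      linear_combination (c j t - c j (t + Pi.single a 1)) * γ a b * two
    have expand : ∑ a ∈ A, (cupCoboundary c (j :: l) (A.erase a) (t + Pi.single a 1) -
          cupCoboundary c (j :: l) (A.erase a) t) =
        ∑ a ∈ A, ∑ b ∈ A.erase a, (c j (t + Pi.single b 1) - c j t) *
          (γ a b - cupCoboundary c l ((A.erase a).erase b) (t + Pi.single b 1)) := by
      simp only [cupCoboundary, Finset.sum_sub_distrib, mul_sub]
      rw [← key]
    rw [expand, sum_sum_erase_symm]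
    refine Finset.sum_eq_zero fun b _ => ?_
    rw [← Finset.mul_sum]
    have := ih (A.erase b) (t + Pi.single b 1)
    convert mul_zero _ using 2
    rw [← this]
    refine Finset.sum_congr rfl fun a _ => ?_
    simp only [γ]
    rw [Finset.erase_right_comm, add_right_comm t]

theorem cupCoboundary_eq_zero_of_constant (c : ι → (ι → ℕ) → ZMod 2) {a : ι} {v : ℕ} {x : ZMod 2}
    (hc : ∀ t, t a = v → c a t = x) (l : List ι) (hl : a ∈ l) (B : Finset ι) (hB : a ∉ B)
    (t : ι → ℕ) (ht : t a = v) : cupCoboundary c l B t = 0 := by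
  induction l generalizing B t with
  | nil => simp at hl
  | cons j l ih =>
    refine Finset.sum_eq_zero fun b hb => ?_
    have hab : a ≠ b := fun h => hB (h ▸ hb)
    have hb' : (t + Pi.single b 1 : ι → ℕ) a = v := by simp [hab, ht]
    by_cases h : a = j
    · subst h
      rw [hc _ hb', hc _ ht, sub_self, zero_mul]
    · rw [ih (by simpa [h] using hl) _ (fun h => hB (Finset.mem_of_mem_erase h)) _ hb', mul_zero]

theorem exists_ne_of_cupCoboundary_ne_zero (c : ι → (ι → ℕ) → ZMod 2) (l : List ι)
    (A : Finset ι) (t : ι → ℕ) (h : cupCoboundary c l A t ≠ 0) :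
    ∀ j ∈ l, ∃ s s' : ι → ℕ, (∀ i, t i ≤ s i ∧ s i ≤ t i + if i ∈ A then 1 else 0) ∧
      (∀ i, t i ≤ s' i ∧ s' i ≤ t i + if i ∈ A then 1 else 0) ∧ c j s ≠ c j s' := by
  induction l generalizing A t with
  | nil => simp
  | cons k l ih =>
    obtain ⟨a, ha, hne⟩ := Finset.exists_ne_zero_of_sum_ne_zero h
    have h1 := left_ne_zero_of_mul hne
    have h2 := ih _ _ (right_ne_zero_of_mul hne)
    have step : ∀ s : ι → ℕ, (∀ i, (t + Pi.single a 1 : ι → ℕ) i ≤ s i ∧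
        s i ≤ (t + Pi.single a 1 : ι → ℕ) i + if i ∈ A.erase a then 1 else 0) →
        ∀ i, t i ≤ s i ∧ s i ≤ t i + if i ∈ A then 1 else 0 := by
      intro s hs i
      have := hs i
      by_cases hi : i = a
      · subst hi
        simp at this
        simp [ha]
        omega
      · simpa [hi] using this
    intro j hj
    rcases List.mem_cons.1 hj with rfl | hj
    · refine ⟨t + Pi.single a 1, t, step _ fun i => by simp, fun i => by simp, sub_ne_zero.1 h1⟩
    · obtain ⟨s, s', hs, hs', hc⟩ := h2 j hj
      exact ⟨s, s', step s hs, step s' hs', hc⟩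

variable [Fintype ι]

/-- The base points of the unit cubes, with directions `A`, of the face of `[0,m]^ι` on which all
coordinates outside `A` vanish. -/
def gridFace (m : ℕ) (A : Finset ι) : Finset (ι → ℕ) :=
  Fintype.piFinset fun i => if i ∈ A then Finset.range m else {0}

theorem mem_gridFace {m : ℕ} {A : Finset ι} {t : ι → ℕ} :
    t ∈ gridFace m A ↔ ∀ i, (i ∈ A → t i < m) ∧ (i ∉ A → t i = 0) := by
  simp only [gridFace, Fintype.mem_piFinset]
  refine forall_congr' fun i => ?_
  by_cases h : i ∈ A <;> simp [h]

theorem sum_gridFace_telescope (m : ℕ) (A : Finset ι) {a : ι} (ha : a ∈ A)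
    (F : (ι → ℕ) → ZMod 2) :
    ∑ t ∈ gridFace m A, (F (t + Pi.single a 1) - F t) =
      ∑ t ∈ gridFace m (A.erase a), (F (t + Pi.single a m) - F t) := by
  have : ∀ t : ι → ℕ, F (t + Pi.single a m) - F t =
      ∑ k ∈ Finset.range m, (F (t + Pi.single a (k + 1)) - F (t + Pi.single a k)) := by
    intro t
    rw [Finset.sum_range_sub (fun k : ℕ => F (t + (Pi.single a k : ι → ℕ)))]
    simp
  simp only [this]
  rw [Finset.sum_sigma']
  symm
  refine Finset.sum_bij' (fun x _ => x.1 + Pi.single a x.2)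
    (fun t _ => ⟨Function.update t a 0, t a⟩) ?_ ?_ ?_ ?_ ?_
  · rintro ⟨t, k⟩ h
    simp only [Finset.mem_sigma, mem_gridFace, Finset.mem_range] at h ⊢
    intro i
    by_cases hi : i = a
    · subst hi
      have := (h.1 i).2 (by simp)
      simp [ha, this, h.2]
    · have := h.1 i
      simpa [hi] using this
  · intro t h
    simp only [Finset.mem_sigma, mem_gridFace, Finset.mem_range] at h ⊢
    refine ⟨fun i => ?_, (h a).1 ha⟩
    by_cases hi : i = a
    · subst hi; simp
    · have := h i
      simpa [hi] using this
  · rintro ⟨t, k⟩ h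
    simp only [Finset.mem_sigma, mem_gridFace, Finset.mem_range] at h
    have h0 := (h.1 a).2 (by simp)
    have : Function.update (t + Pi.single a k) a 0 = t := by
      ext i
      by_cases hi : i = a
      · subst hi; simp [h0]
      · simp [hi]
    simp [this, h0]
  · intro t h
    ext i
    by_cases hi : i = a
    · subst hi; simp
    · simp [hi]
  · rintro ⟨t, k⟩ h
    simp only [Pi.single_add, add_assoc]

theorem sum_cupCoboundary (c : ι → (ι → ℕ) → ZMod 2) (m : ℕ) (h0 : ∀ i t, t i = 0 → c i t = 1)
    (hm : ∀ i t, t i = m → c i t = 0) (l : List ι) (hl : l.Nodup) :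
    ∑ t ∈ gridFace m l.toFinset, cupCoboundary c l l.toFinset t = 1 := by
  induction l with
  | nil =>
    have : gridFace m (∅ : Finset ι) = {0} := by
      ext t
      simp [mem_gridFace, funext_iff]
    simp [cupCoboundary, this]
  | cons j l ih =>
    rw [List.nodup_cons] at hl
    set A := (j :: l).toFinset with hA
    have hAj : A.erase j = l.toFinset := by
      rw [hA, List.toFinset_cons, Finset.erase_insert (by simpa using hl.1)]
    let F : ι → (ι → ℕ) → ZMod 2 := fun a t => c j t * cupCoboundary c l (A.erase a) t
    have leibniz : ∀ t, cupCoboundary c (j :: l) A t =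
        ∑ a ∈ A, (F a (t + Pi.single a 1) - F a t) := by
      intro t
      have := cupCoboundary_closed c l A t
      have e : cupCoboundary c (j :: l) A t = cupCoboundary c (j :: l) A t +
        c j t * ∑ a ∈ A, (cupCoboundary c l (A.erase a) (t + Pi.single a 1) -
          cupCoboundary c l (A.erase a) t) := by rw [this, mul_zero, add_zero]
      rw [e, Finset.mul_sum, cupCoboundary, ← Finset.sum_add_distrib]
      refine Finset.sum_congr rfl fun a _ => ?_
      simp only [F]
      ring
    simp only [leibniz]
    rw [Finset.sum_comm]
    rw [Finset.sum_eq_single_of_mem j (by simp [hA])]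
    · rw [sum_gridFace_telescope m A (by simp [hA]), hAj, Finset.sum_sub_distrib]
      rw [Finset.sum_eq_zero, zero_sub]
      · rw [show (1 : ZMod 2) = -1 from rfl, ← ih hl.2]
        congr 1
        refine Finset.sum_congr rfl fun t ht => ?_
        simp only [F, hAj]
        rw [h0 j t ((mem_gridFace.1 ht j).2 (by simpa using hl.1)), one_mul]
      · intro t ht
        simp only [F]
        rw [hm j, zero_mul]
        simp [(mem_gridFace.1 ht j).2 (by simpa using hl.1)]
    · intro a ha haj
      have hal : a ∈ l := by simpa [hA, haj] using ha
      rw [sum_gridFace_telescope m A ha]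
      refine Finset.sum_eq_zero fun t ht => ?_
      have hta := (mem_gridFace.1 ht a).2 (by simp)
      simp only [F]
      rw [cupCoboundary_eq_zero_of_constant c (h0 a) l hal _ (by simp) t hta,
        cupCoboundary_eq_zero_of_constant c (hm a) l hal _ (by simp) _ (by simp [hta])]
      simp

/-- A discrete Poincaré–Miranda theorem: if `S i` holds on the face `t i = 0` and fails on the face
`t i = m`, then some unit cube contains, for every `i`, points where `S i` holds and where it
fails. -/
theorem exists_cube_of_faces (m : ℕ) (S : ι → (ι → ℕ) → Prop)
    (h0 : ∀ i t, t i = 0 → S i t) (hm : ∀ i t, t i = m → ¬ S i t) :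
    ∃ t : ι → ℕ, ∀ j, ∃ s s' : ι → ℕ, (∀ i, t i ≤ s i ∧ s i ≤ t i + 1) ∧
      (∀ i, t i ≤ s' i ∧ s' i ≤ t i + 1) ∧ S j s ∧ ¬ S j s' := by
  classical
  let c : ι → (ι → ℕ) → ZMod 2 := fun i t => if S i t then 1 else 0
  have hsum := sum_cupCoboundary c m (fun i t h => by simp [c, h0 i t h])
    (fun i t h => by simp [c, hm i t h]) Finset.univ.toList (Finset.nodup_toList _)
  obtain ⟨t, -, ht⟩ := Finset.exists_ne_zero_of_sum_ne_zero (hsum.trans_ne one_ne_zero)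
  refine ⟨t, fun j => ?_⟩
  obtain ⟨s, s', hs, hs', hne⟩ := exists_ne_of_cupCoboundary_ne_zero c _ _ t ht j (by simp)
  simp only [Finset.toList_toFinset, Finset.mem_univ, if_true] at hs hs'
  by_cases h : S j s
  · refine ⟨s, s', hs, hs', h, fun h' => hne ?_⟩
    simp [c, h, h']
  · refine ⟨s', s, hs', hs, ?_, h⟩
    by_contra h'
    exact hne (by simp [c, h, h'])

end PoincareMiranda

section Colouring

/-- The distance from `y` to the nearest multiples of `P` below and above. -/
def periodicBump (P y : ℕ) : ℕ := min (y % P) (P - y % P)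

theorem periodicBump_succ {P : ℕ} (hP : 0 < P) (y : ℕ) :
    periodicBump P (y + 1) ≤ periodicBump P y + 1 ∧ periodicBump P y ≤ periodicBump P (y + 1) + 1 ∧
      (y / P = (y + 1) / P ∨ periodicBump P (y + 1) = 0) := by
  have hlt := Nat.mod_lt y hP
  have h1 : (y + 1) % P = (y % P + 1) % P := (Nat.mod_add_mod y P 1).symm
  simp only [periodicBump]
  by_cases h : y % P + 1 = P
  · rw [h, Nat.mod_self] at h1
    generalize (y + 1) % P = b at *
    generalize y % P = a at *
    omega
  · rw [Nat.mod_eq_of_lt (a := y % P + 1) (by omega)] at h1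
    have hdiv : y / P = (y + 1) / P := by
      rw [Nat.succ_div, if_neg, add_zero]
      intro hd
      rw [Nat.dvd_iff_mod_eq_zero] at hd
      omega
    generalize (y + 1) % P = b at *
    generalize y % P = a at *
    omega

theorem periodicBump_close {P : ℕ} (hP : 0 < P) {y y' : ℕ} (h : y ≤ y' + 1) (h' : y' ≤ y + 1) :
    periodicBump P y ≤ periodicBump P y' + 1 ∧
      (0 < periodicBump P y → 0 < periodicBump P y' → y / P = y' / P) := by
  rcases (by omega : y = y' ∨ y = y' + 1 ∨ y' = y + 1) with rfl | rfl | rfl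
  · exact ⟨by omega, fun _ _ => rfl⟩
  · have := periodicBump_succ hP y'
    exact ⟨this.1, fun h _ => by omega⟩
  · have := periodicBump_succ hP y
    exact ⟨this.2.1, fun _ h => by omega⟩

variable {ι : Type*} [Fintype ι]

/-- The depth of `y` inside the cell of the cubical lattice `(Pℕ)^ι` containing it, truncated
at `r`. -/
def cellDepth (r P : ℕ) (y : ι → ℕ) : ℕ := r - Finset.univ.sup fun i => r - periodicBump P (y i)

theorem cellDepth_close {r P : ℕ} (hP : 0 < P) {y y' : ι → ℕ}
    (h : ∀ i, y i ≤ y' i + 1) (h' : ∀ i, y' i ≤ y i + 1) :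
    cellDepth r P y ≤ cellDepth r P y' + 1 ∧
      (0 < cellDepth r P y → 0 < cellDepth r P y' → ∀ i, y i / P = y' i / P) := by
  have key : (Finset.univ.sup fun i => r - periodicBump P (y' i)) ≤
      (Finset.univ.sup fun i => r - periodicBump P (y i)) + 1 := by
    refine Finset.sup_le fun i _ => ?_
    have h1 := Finset.le_sup (f := fun i => r - periodicBump P (y i)) (Finset.mem_univ i)
    have h2 := (periodicBump_close hP (h i) (h' i)).1
    omega
  refine ⟨by unfold cellDepth; omega, fun hy hy' i => ?_⟩
  have h1 := Finset.le_sup (f := fun i => r - periodicBump P (y i)) (Finset.mem_univ i)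
  have h2 := Finset.le_sup (f := fun i => r - periodicBump P (y' i)) (Finset.mem_univ i)
  unfold cellDepth at hy hy'
  exact (periodicBump_close hP (h i) (h' i)).2 (by omega) (by omega)

theorem cellDepth_le (r P : ℕ) (y : ι → ℕ) : cellDepth r P y ≤ r := Nat.sub_le _ _

/-- The translation by which the lattice of colour `k` is shifted. -/
def colourShift (r n k : ℕ) : ℕ := 2 * r * n - (2 * r * k + r)

theorem exists_cellDepth_eq {r n : ℕ} (hr : 0 < r) (hn : Fintype.card ι < n) (t : ι → ℕ) :
    ∃ k : Fin n, cellDepth r (2 * r * n) (fun i => t i + colourShift r n k) = r := by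
  obtain ⟨k, hk⟩ : ∃ k : Fin n, ∀ i, t i % (2 * r * n) / (2 * r) ≠ k := by
    by_contra! hcon
    choose g hg using hcon
    have : Function.Injective g := fun k k' h => Fin.ext (by rw [← hg k, ← hg k', h])
    have := Fintype.card_le_of_injective g this
    rw [Fintype.card_fin] at this
    omega
  refine ⟨k, ?_⟩
  have hzero : (Finset.univ.sup fun i =>
      r - periodicBump (2 * r * n) (t i + colourShift r n k)) = 0 := by
    rw [← Nat.bot_eq_zero, Finset.sup_eq_bot_iff]
    intro i _
    rw [Nat.bot_eq_zero, Nat.sub_eq_zero_iff_le]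
    by_contra! hlt
    apply hk i
    have hP : 0 < 2 * r * n := by have := k.pos; positivity
    have hkn : 2 * r * k + 2 * r ≤ 2 * r * n := by
      have := Nat.mul_le_mul_left (2 * r) (Nat.succ_le_of_lt k.2)
      rwa [Nat.mul_succ] at this
    unfold periodicBump colourShift at hlt
    generalize hPdef : 2 * r * n = P at *
    have hx := Nat.mod_lt (t i) hP
    have e : (t i + (P - (2 * r * k + r))) % P = (t i % P + (P - (2 * r * k + r))) % P :=
      (Nat.mod_add_mod _ _ _).symm
    rw [e] at hlt
    generalize t i % P = x at *
    rw [Nat.div_eq_iff (by omega), mul_comm (k : ℕ)]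
    generalize 2 * r * (k : ℕ) = c at *
    by_cases hc : x + (P - (c + r)) < P
    · rw [Nat.mod_eq_of_lt hc] at hlt
      omega
    · rw [Nat.mod_eq_sub_mod (by omega), Nat.mod_eq_of_lt (by omega)] at hlt
      omega
  simp [cellDepth, hzero]

end Colouring

section CubicTree

theorem eq_of_adj_of_dist_eq {V : Type*} {G : SimpleGraph V} (hc : G.Connected)
    (ha : G.IsAcyclic) {o u a b : V} {k : ℕ} (hau : G.Adj a u) (hbu : G.Adj b u)
    (hka : G.dist o a = k) (hkb : G.dist o b = k) (hku : G.dist o u = k + 1) : a = b := by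
  obtain ⟨p, -, hp⟩ := hc.exists_path_of_dist o a
  obtain ⟨q, -, hq⟩ := hc.exists_path_of_dist o b
  have hp' : (p.concat hau).IsPath :=
    SimpleGraph.Walk.isPath_of_length_eq_dist _ (by simp [hp, hka, hku])
  have hq' : (q.concat hbu).IsPath :=
    SimpleGraph.Walk.isPath_of_length_eq_dist _ (by simp [hq, hkb, hku])
  have := congrArg (fun P : G.Path o u => P.1.penultimate)
    ((ha.subsingleton_path o u).elim ⟨_, hp'⟩ ⟨_, hq'⟩)
  simpa using this

theorem two_le_ncard_children {V : Type*} {G : SimpleGraph V} (hc : G.Connected)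
    (ha : G.IsAcyclic) (h3 : ∀ v, (G.neighborSet v).ncard = 3) (o v : V) :
    2 ≤ {u | G.Adj v u ∧ G.dist o u = G.dist o v + 1}.ncard := by
  have hfin : (G.neighborSet v).Finite := Set.finite_of_ncard_ne_zero (by rw [h3]; norm_num)
  have hcover : G.neighborSet v ⊆ {u | G.Adj v u ∧ G.dist o u = G.dist o v + 1} ∪
      {u | G.Adj v u ∧ G.dist o v = G.dist o u + 1} := by
    intro u hu
    rcases SimpleGraph.IsTree.dist_eq_dist_add_one_of_adj ⟨hc, ha⟩ o hu with h | h
    · exact Or.inr ⟨hu, h⟩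
    · exact Or.inl ⟨hu, h⟩
  have hpar : {u | G.Adj v u ∧ G.dist o v = G.dist o u + 1}.ncard ≤ 1 := by
    rw [Set.ncard_le_one (hfin.subset fun u hu => hu.1)]
    intro x hx y hy
    exact eq_of_adj_of_dist_eq hc ha hx.1.symm hy.1.symm rfl
      (by have := hx.2; have := hy.2; omega) hx.2
  have h1 := Set.ncard_le_ncard hcover
    ((hfin.subset fun u hu => hu.1).union (hfin.subset fun u hu => hu.1))
  have h2 := Set.ncard_union_le {u | G.Adj v u ∧ G.dist o u = G.dist o v + 1}
      {u | G.Adj v u ∧ G.dist o v = G.dist o u + 1}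
  rw [h3] at h1
  omega

theorem exists_finset_sphere {V : Type*} {G : SimpleGraph V} (hc : G.Connected)
    (ha : G.IsAcyclic) (h3 : ∀ v, (G.neighborSet v).ncard = 3) (o : V) (r : ℕ) :
    ∃ L : Finset V, 2 ^ r ≤ L.card ∧ ∀ v ∈ L, G.dist o v = r := by
  classical
  induction r with
  | zero => exact ⟨{o}, by simp⟩
  | succ r ih =>
    obtain ⟨L, hL, hLr⟩ := ih
    have hfin : ∀ v, {u | G.Adj v u ∧ G.dist o u = G.dist o v + 1}.Finite := fun v =>
      Set.finite_of_ncard_ne_zero (by have := two_le_ncard_children hc ha h3 o v; omega)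
    refine ⟨L.biUnion fun v => (hfin v).toFinset, ?_, ?_⟩
    · rw [Finset.card_biUnion]
      · have : ∑ v ∈ L, 2 ≤ ∑ v ∈ L, (hfin v).toFinset.card := by
          refine Finset.sum_le_sum fun v _ => ?_
          rw [← Set.ncard_eq_toFinset_card _ (hfin v)]
          exact two_le_ncard_children hc ha h3 o v
        rw [Finset.sum_const, smul_eq_mul] at this
        rw [pow_succ]
        omega
      · intro x hx y hy hxy
        refine Finset.disjoint_left.2 ?_
        intro u hux huy
        simp only [Set.Finite.mem_toFinset, Set.mem_ofPred_eq] at hux huy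
        exact hxy (eq_of_adj_of_dist_eq hc ha hux.1 huy.1 (hLr x hx) (hLr y hy)
          (by rw [hux.2, hLr x hx]))
    · intro u hu
      simp only [Finset.mem_biUnion, Set.Finite.mem_toFinset, Set.mem_ofPred_eq] at hu
      obtain ⟨v, hv, -, h⟩ := hu
      rw [h, hLr v hv]

theorem IsCubicTreeMetric.exists_rays {T : Type*} [MetricSpace T] (hT : IsCubicTreeMetric T)
    (o : T) (r : ℕ) : ∃ (L : Finset T) (γ : T → ℕ → T), 2 ^ r ≤ L.card ∧ (∀ v, γ v 0 = o) ∧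
      (∀ v j, dist (γ v j) (γ v (j + 1)) ≤ 1) ∧ ∀ v ∈ L, γ v r = v := by
  obtain ⟨G, hc, ha, h3, hd⟩ := hT
  obtain ⟨L, hL, hLr⟩ := exists_finset_sphere hc ha h3 o r
  choose w hw using fun v => hc.exists_walk_length_eq_dist o v
  refine ⟨L, fun v j => (w v).getVert j, hL, fun v => (w v).getVert_zero, fun v j => ?_,
    fun v hv => ?_⟩
  · rw [hd]
    dsimp only
    rcases lt_or_ge j (w v).length with h | h
    · rw [SimpleGraph.dist_eq_one_iff_adj.2 ((w v).adj_getVert_succ h), Nat.cast_one]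
    · rw [(w v).getVert_of_length_le h, (w v).getVert_of_length_le (by omega)]
      simp
  · rw [← hLr v hv, ← hw v]
    exact (w v).getVert_length

theorem IsCubicTreeMetric.one_le_dist {T : Type*} [MetricSpace T] (hT : IsCubicTreeMetric T)
    {u v : T} (h : u ≠ v) : 1 ≤ dist u v := by
  obtain ⟨G, hc, -, -, hd⟩ := hT
  rw [hd]
  exact_mod_cast hc.pos_dist_of_ne h

end CubicTree

section ColouredMap

/-- Coloured rays: assigning to every cell `z` of every colour `k` an endpoint `ℓ k z` in a tree
yields a Lipschitz map from a grid to a product of trees, which at each point of the grid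
reaches in some coordinate the endpoint assigned to the cell containing it. -/
theorem exists_coloured_map {T : Type*} [MetricSpace T] {o : T} {γ : T → ℕ → T}
    (h0 : ∀ v, γ v 0 = o) (h1 : ∀ v j, dist (γ v j) (γ v (j + 1)) ≤ 1)
    {ι : Type*} [Fintype ι] {r n : ℕ} (hr : 0 < r) (hn : Fintype.card ι < n)
    (ℓ : Fin n → (ι → ℕ) → T) :
    ∃ s : (ι → ℕ) → Fin n → T,
      (∀ t t', (∀ i, t i ≤ t' i + 1) → (∀ i, t' i ≤ t i + 1) → ∀ k, dist (s t k) (s t' k) ≤ 1) ∧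
      (∀ t k, dist (s t k) o ≤ r) ∧
      ∀ t, ∃ (k : Fin n) (z : ι → ℕ), s t k = γ (ℓ k z) r ∧
        ∀ i, z i * (2 * r * n) ≤ t i + colourShift r n k ∧
          t i + colourShift r n k < z i * (2 * r * n) + 2 * r * n := by
  have hP : 0 < 2 * r * n := by
    have : 0 < n := by omega
    positivity
  let y : (ι → ℕ) → Fin n → ι → ℕ := fun t k i => t i + colourShift r n k
  let ρ : (ι → ℕ) → Fin n → ℕ := fun t k => cellDepth r (2 * r * n) (y t k)
  let z : (ι → ℕ) → Fin n → ι → ℕ := fun t k i => y t k i / (2 * r * n)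
  have hdist : ∀ v j, dist (γ v j) o ≤ j := by
    intro v j
    induction j with
    | zero => simp [h0]
    | succ j ih =>
      have := dist_triangle_left (γ v (j + 1)) o (γ v j)
      have := h1 v j
      push_cast
      linarith
  refine ⟨fun t k => γ (ℓ k (z t k)) (ρ t k), ?_, ?_, ?_⟩
  · intro t t' ht ht' k
    have c1 := cellDepth_close (r := r) hP (y := y t k) (y' := y t' k)
      (fun i => by have := ht i; simp only [y]; omega)
      (fun i => by have := ht' i; simp only [y]; omega)
    have c2 := cellDepth_close (r := r) hP (y := y t' k) (y' := y t k)
      (fun i => by have := ht' i; simp only [y]; omega)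
      (fun i => by have := ht i; simp only [y]; omega)
    have d1 : ρ t k ≤ ρ t' k + 1 := c1.1
    have d2 : ρ t' k ≤ ρ t k + 1 := c2.1
    by_cases hpos : 0 < ρ t k ∧ 0 < ρ t' k
    · have hz : z t k = z t' k := funext (c1.2 hpos.1 hpos.2)
      simp only [hz]
      rcases (by omega : ρ t k = ρ t' k ∨ ρ t k = ρ t' k + 1 ∨ ρ t' k = ρ t k + 1)
        with h | h | h
      · simp [h]
      · rw [h, dist_comm]
        exact h1 _ _
      · rw [h]
        exact h1 _ _
    · rcases (by omega : ρ t k = 0 ∨ ρ t' k = 0) with h | h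
      · simp only [h, h0]
        rw [dist_comm]
        exact (hdist _ _).trans (by exact_mod_cast (by omega : ρ t' k ≤ 1))
      · simp only [h, h0]
        exact (hdist _ _).trans (by exact_mod_cast (by omega : ρ t k ≤ 1))
  · intro t k
    exact (hdist _ _).trans (by exact_mod_cast cellDepth_le _ _ _)
  · intro t
    obtain ⟨k, hk⟩ := exists_cellDepth_eq hr hn t
    refine ⟨k, z t k, ?_, fun i => ?_⟩
    · simp only [ρ, y, hk]
    · have e : y t k i = t i + colourShift r n k := rfl
      rw [← e]
      exact ⟨Nat.div_mul_le_self _ _, Nat.lt_div_mul_add hP⟩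

end ColouredMap

section HyperbolicPlane

open UpperHalfPlane

theorem UpperHalfPlane.abs_re_sub_le (z w : UpperHalfPlane) :
    |z.re - w.re| ≤ w.im * (Real.exp (dist z w) - 1) := by
  refine le_trans ?_ (UpperHalfPlane.dist_coe_le z w)
  rw [Complex.dist_eq]
  simpa using Complex.abs_re_le_norm ((z : ℂ) - w)

theorem UpperHalfPlane.dist_le_of_close {z w : UpperHalfPlane} {τ A ε : ℝ} (hA : 0 ≤ A)
    (hε : 0 < ε) (hε1 : ε ≤ 1) (hz : |z.re - τ| ≤ A * z.im) (hw : |w.re - τ| ≤ A * w.im)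
    (h1 : |(z.re - τ) / z.im - (w.re - τ) / w.im| ≤ ε)
    (h2 : |Real.log z.im - Real.log w.im| ≤ ε) : dist z w ≤ (2 * A + 3) * ε := by
  wlog hle : w.im ≤ z.im generalizing z w
  · rw [dist_comm]
    exact this hw hz (by rwa [abs_sub_comm]) (by rwa [abs_sub_comm]) (le_of_not_ge hle)
  have hzp := z.im_pos
  have hwp := w.im_pos
  have him : z.im - w.im ≤ 2 * ε * w.im := by
    have h3 : z.im ≤ w.im * Real.exp ε := by
      have : Real.exp (Real.log z.im) ≤ Real.exp (Real.log w.im + ε) :=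
        Real.exp_le_exp.2 (by linarith [(abs_le.1 h2).2])
      rwa [Real.exp_add, Real.exp_log hzp, Real.exp_log hwp] at this
    have h4 : Real.exp ε ≤ 1 + 2 * ε := by
      have := abs_le.1 (Real.abs_exp_sub_one_le (x := ε) (by rwa [abs_of_pos hε]))
      rw [abs_of_pos hε] at this
      linarith
    nlinarith
  have hre : |z.re - w.re| ≤ (2 * A + 1) * ε * w.im := by
    have e : z.re - w.re = ((z.re - τ) / z.im - (w.re - τ) / w.im) * w.im +
        (z.re - τ) / z.im * (z.im - w.im) := by
      field_simp
      ring
    have h5 : |(z.re - τ) / z.im| ≤ A := by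
      rw [abs_div, abs_of_pos hzp, div_le_iff₀ hzp]
      exact hz
    rw [e]
    refine (abs_add_le _ _).trans ?_
    rw [abs_mul, abs_mul, abs_of_pos hwp, abs_of_nonneg (sub_nonneg.2 hle)]
    have := mul_le_mul_of_nonneg_right h1 hwp.le
    have := mul_le_mul h5 him (sub_nonneg.2 hle) hA
    linarith
  refine (UpperHalfPlane.dist_le_dist_coe_div_sqrt z w).trans ?_
  have hsqrt : w.im ≤ √(z.im * w.im) := Real.le_sqrt_of_sq_le (by nlinarith)
  rw [div_le_iff₀ (hwp.trans_le hsqrt)]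
  have hdist : dist (z : ℂ) w ≤ |z.re - w.re| + |z.im - w.im| := by
    rw [Complex.dist_eq]
    simpa using Complex.norm_le_abs_re_add_abs_im ((z : ℂ) - w)
  rw [abs_of_nonneg (sub_nonneg.2 hle)] at hdist
  have : (2 * A + 3) * ε * w.im ≤ (2 * A + 3) * ε * √(z.im * w.im) := by gcongr
  nlinarith

end HyperbolicPlane

section Growth

theorem abs_sub_le_of_floor_eq {q : ℕ} (hq : 0 < q) {x y : ℝ} (h : ⌊q * x⌋ = ⌊q * y⌋) :
    |x - y| ≤ 1 / q := by
  have hq' : (0 : ℝ) < q := by exact_mod_cast hq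
  have := (Int.abs_sub_lt_one_of_floor_eq_floor h).le
  rwa [← mul_sub, abs_mul, abs_of_pos hq', ← le_div_iff₀' hq'] at this

theorem floor_mul_mem_Icc {q M : ℕ} {x : ℝ} (h : |x| ≤ M) :
    ⌊q * x⌋ ∈ Finset.Icc (-(q * M : ℤ)) (q * M) := by
  obtain ⟨h1, h2⟩ := abs_le.1 h
  rw [Finset.mem_Icc]
  have hq : (0 : ℝ) ≤ q := q.cast_nonneg
  constructor
  · rw [Int.le_floor]
    push_cast
    nlinarith
  · have : (⌊q * x⌋ : ℝ) ≤ q * M := (Int.floor_le _).trans (by gcongr)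
    exact_mod_cast this

theorem card_Icc_neg_mul (q M : ℕ) : (Finset.Icc (-(q * M : ℤ)) (q * M)).card = 2 * q * M + 1 := by
  have h : (0 : ℤ) ≤ q * M := by positivity
  rw [Int.card_Icc]
  zify
  rw [Int.toNat_of_nonneg (by linarith)]
  ring

/-- A product of cones around vertical lines and of `Z` has subexponential growth: this bounds
the cardinality of a finite set of points lying in a ball of this product, up to multiplicity. -/
theorem card_le_of_mem_cones {D Z ι : Type*} [Fintype ι] [MetricSpace Z] {g : ℝ → ℝ}
    (hg : HasGrowthBound Z g) {A q κ R : ℕ} (hq : Fintype.card ι * (2 * A + 3) < q)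
    (h : D → ι → UpperHalfPlane) (ζ : D → Z)
    (hκ : ∀ (p : D) (F : Finset D),
      (∀ p' ∈ F, ∑ i, dist (h p' i) (h p i) + dist (ζ p') (ζ p) < 1) → F.card ≤ κ)
    (o : D) (τ : ι → ℝ) (W : Finset D)
    (hR : ∀ p ∈ W, (∀ i, dist (h p i) (h o i) ≤ R) ∧ dist (ζ p) (ζ o) ≤ R)
    (hA : ∀ p ∈ W, ∀ i, |(h p i).re - τ i| ≤ A * (h p i).im) :
    (W.card : ℝ) ≤ κ * ((2 * q * A + 1) * (2 * q * R + 1)) ^ Fintype.card ι * g R := by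
  classical
  have hqpos : 0 < q := by omega
  have hq0 : (0 : ℝ) < q := by exact_mod_cast hqpos
  let α : D → ι → ℤ × ℤ := fun p i => (⌊q * (((h p i).re - τ i) / (h p i).im)⌋,
    ⌊q * (Real.log (h p i).im - Real.log (h o i).im)⌋)
  let box : Finset (ι → ℤ × ℤ) := Fintype.piFinset fun _ =>
    Finset.Icc (-(q * A : ℤ)) (q * A) ×ˢ Finset.Icc (-(q * R : ℤ)) (q * R)
  let cls : D → (ι → ℤ × ℤ) × Z := fun p => (α p, ζ p)
  have himg : W.image cls ⊆ box ×ˢ W.image ζ := by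
    intro x hx
    obtain ⟨p, hp, rfl⟩ := Finset.mem_image.1 hx
    simp only [cls, Finset.mem_product, Finset.mem_image_of_mem ζ hp, and_true, box,
      Fintype.mem_piFinset]
    intro i
    refine ⟨floor_mul_mem_Icc ?_, floor_mul_mem_Icc ?_⟩
    · rw [abs_div, abs_of_pos (h p i).im_pos, div_le_iff₀ (h p i).im_pos]
      exact hA p hp i
    · rw [← Real.dist_eq]
      exact (UpperHalfPlane.dist_log_im_le _ _).trans ((hR p hp).1 i)
  have hbox : box.card = ((2 * q * A + 1) * (2 * q * R + 1)) ^ Fintype.card ι := by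
    rw [Fintype.card_piFinset, Finset.prod_const, Finset.card_univ, Finset.card_product,
      card_Icc_neg_mul, card_Icc_neg_mul]
  have hZ : ((W.image ζ).card : ℝ) ≤ g R := by
    refine hg (ζ o) R R.cast_nonneg _ ?_
    intro x hx
    obtain ⟨p, hp, rfl⟩ := Finset.mem_image.1 (Finset.mem_coe.1 hx)
    exact (hR p hp).2
  have hfib : ∀ x ∈ W.image cls, (W.filter fun p => cls p = x).card ≤ κ := by
    intro x hx
    obtain ⟨p, hp, rfl⟩ := Finset.mem_image.1 hx
    refine hκ p _ fun p' hp' => ?_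
    obtain ⟨hp'W, hcls⟩ := Finset.mem_filter.1 hp'
    have hα : α p' = α p := congrArg Prod.fst hcls
    have hζ : ζ p' = ζ p := congrArg Prod.snd hcls
    have hi : ∀ i, dist (h p' i) (h p i) ≤ (2 * A + 3) * (1 / q) := by
      intro i
      have hαi := congrFun hα i
      refine UpperHalfPlane.dist_le_of_close A.cast_nonneg (by positivity) ?_ (hA p' hp'W i)
        (hA p hp i) (abs_sub_le_of_floor_eq hqpos (congrArg Prod.fst hαi)) ?_
      · rw [div_le_one hq0]
        exact_mod_cast hqpos
      · have := abs_sub_le_of_floor_eq hqpos (congrArg Prod.snd hαi)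
        rwa [sub_sub_sub_cancel_right] at this
    have hsum := Finset.sum_le_sum fun i (_ : i ∈ Finset.univ) => hi i
    rw [Finset.sum_const, Finset.card_univ, nsmul_eq_mul] at hsum
    rw [hζ, dist_self, add_zero]
    refine hsum.trans_lt ?_
    rw [← mul_assoc, mul_one_div, div_lt_one hq0]
    exact_mod_cast hq
  have hcard := Finset.card_le_mul_card_image (s := W) κ hfib
  have h1 : (W.card : ℝ) ≤ κ * (box.card * (W.image ζ).card) := by
    have := hcard.trans (Nat.mul_le_mul_left κ (Finset.card_le_card himg))
    rw [Finset.card_product] at this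
    exact_mod_cast this
  rw [hbox] at h1
  push_cast at h1
  refine h1.trans ?_
  rw [mul_assoc (κ : ℝ)]
  exact mul_le_mul_of_nonneg_left (mul_le_mul_of_nonneg_left hZ (by positivity)) (by positivity)

theorem SubexpFun.exists_lt_two_pow {g : ℝ → ℝ} (hg : SubexpFun g)
    (hgpos : ∀ r, 0 ≤ r → 0 < g r) {C : ℝ} (hC : 0 ≤ C) {a : ℝ} (ha : 0 ≤ a) (d : ℕ) {c : ℕ}
    (hc : 0 < c) :
    ∃ r : ℕ, 0 < r ∧
      C * (a * (c * (1 + r) : ℕ) + 1) ^ d * g (c * (1 + r) : ℕ) < 2 ^ r := by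
  have hc' : (0 : ℝ) < c := by exact_mod_cast hc
  set ε : ℝ := Real.log 2 / (4 * c) with hε
  have hεpos : 0 < ε := by have := Real.log_pos one_lt_two; positivity
  have e1 : ∀ᶠ R in Filter.atTop, g R ≤ Real.exp (ε * R) := by
    filter_upwards [hg.2.2.eventually_lt_const hεpos, Filter.eventually_gt_atTop 0] with R hR hR0
    rw [div_lt_iff₀ hR0] at hR
    rw [← Real.log_le_iff_le_exp (hgpos R hR0.le)]
    exact hR.le
  set B : ℝ := C * (a + 1) ^ d with hB
  have hB0 : 0 ≤ B := by positivity
  have e2 : ∀ᶠ R in Filter.atTop, C * (a * R + 1) ^ d < Real.exp (ε * R) := by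
    filter_upwards [(isLittleO_pow_exp_pos_mul_atTop d hεpos).bound
      (show 0 < 1 / (B + 1) by positivity), Filter.eventually_ge_atTop 1] with R hR hR1
    rw [Real.norm_of_nonneg (by positivity), Real.norm_of_nonneg (by positivity), one_div,
      ← div_eq_inv_mul, le_div_iff₀ (by positivity)] at hR
    have h1 : (a * R + 1) ^ d ≤ (a + 1) ^ d * R ^ d := by
      rw [← mul_pow]
      gcongr
      linarith
    have h2 : 0 < R ^ d := by positivity
    have h3 := mul_le_mul_of_nonneg_left h1 hC
    rw [← mul_assoc, ← hB] at h3
    linarith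
  have hlim : Filter.Tendsto (fun r : ℕ => ((c * (1 + r) : ℕ) : ℝ)) Filter.atTop Filter.atTop := by
    refine tendsto_natCast_atTop_atTop.comp ?_
    refine Filter.tendsto_atTop_mono (fun r => ?_) Filter.tendsto_id
    have := Nat.le_mul_of_pos_left (1 + r) hc
    simp only [id]
    omega
  obtain ⟨r, ⟨h1, h2⟩, hr⟩ :=
    ((hlim.eventually (e1.and e2)).and (Filter.eventually_gt_atTop 0)).exists
  refine ⟨r, hr, ?_⟩
  have hr1 : (1 : ℝ) ≤ r := by exact_mod_cast hr
  calc C * (a * (c * (1 + r) : ℕ) + 1) ^ d * g (c * (1 + r) : ℕ)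
      < Real.exp (ε * (c * (1 + r) : ℕ)) * Real.exp (ε * (c * (1 + r) : ℕ)) :=
        mul_lt_mul h2 h1 (hgpos _ (Nat.cast_nonneg _)) (Real.exp_pos _).le
    _ = Real.exp (2 * ε * (c * (1 + r) : ℕ)) := by rw [← Real.exp_add]; ring_nf
    _ ≤ Real.exp (Real.log 2 * r) := by
        rw [Real.exp_le_exp]
        have : 2 * ε * (c * (1 + r) : ℕ) = Real.log 2 * ((1 + r) / 2) := by
          rw [hε]
          push_cast
          field_simp
          ring
        rw [this]
        have := Real.log_pos one_lt_two
        gcongr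
        linarith
    _ = 2 ^ r := by rw [Real.exp_mul, Real.exp_log two_pos, Real.rpow_natCast]

end Growth

/-- Any map from a box of a power of `T` to a product of fewer hyperbolic planes has a product
of cones around vertical lines whose preimage meets the ends of all the rays `γ x` in one of the
coordinates. -/
theorem exists_cone_meeting_all_rays {T : Type*} [MetricSpace T] {o : T} {γ : T → ℕ → T}
    (h0 : ∀ v, γ v 0 = o) (h1 : ∀ v j, dist (γ v j) (γ v (j + 1)) ≤ 1)
    {ι : Type*} [Fintype ι] {r n : ℕ} (hr : 0 < r) (hn : Fintype.card ι < n)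
    (h : (Fin n → T) → ι → UpperHalfPlane) {K : ℝ}
    (hK : ∀ v w : Fin n → T, (∀ k, dist (v k) (w k) ≤ 1) → ∀ i, dist (h v i) (h w i) ≤ K)
    {A : ℝ} (hA : Real.exp K + 1 ≤ A) (b : ι → ℝ) {B δ : ℝ} (hδ : 0 < δ)
    (hbox : ∀ v : Fin n → T, (∀ k, dist (v k) o ≤ r) →
      ∀ i, δ ≤ (h v i).im ∧ |(h v i).re - b i| < B) :
    ∃ (k : Fin n) (τ : ι → ℝ), ∀ x, ∃ v : Fin n → T, (∀ k, dist (v k) o ≤ r) ∧ v k = γ x r ∧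
      ∀ i, |(h v i).re - τ i| ≤ A * (h v i).im := by
  classical
  by_contra! hmiss
  have hP : 0 < 2 * r * n := by have : 0 < n := by omega
                                positivity
  have hP' : (1 : ℝ) ≤ (2 * r * n : ℕ) := by exact_mod_cast hP
  set η : ℝ := δ / (2 * r * n : ℕ) with hη
  have hη0 : 0 < η := by positivity
  have hηP : η * (2 * r * n : ℕ) = δ := by rw [hη]; field_simp
  have hηδ : η ≤ δ := by nlinarith
  choose ℓ hℓ using fun (k : Fin n) (z : ι → ℕ) =>
    hmiss k fun i => b i - B + η * (z i * (2 * r * n : ℕ) - colourShift r n k : ℝ)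
  obtain ⟨s, hs1, hs2, hs3⟩ := exists_coloured_map h0 h1 hr hn ℓ
  obtain ⟨m, hm⟩ := exists_nat_gt (2 * B / η)
  rw [div_lt_iff₀ hη0] at hm
  obtain ⟨t, ht⟩ := exists_cube_of_faces m
    (fun i t => b i - B + η * t i ≤ (h (s t) i).re)
    (fun i t ht => by
      have := abs_lt.1 (hbox (s t) (hs2 t) i).2
      rw [ht, Nat.cast_zero, mul_zero]
      linarith)
    (fun i t ht hle => by
      have := abs_lt.1 (hbox (s t) (hs2 t) i).2
      rw [ht] at hle
      linarith)
  obtain ⟨k, z, hk, hz⟩ := hs3 t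
  obtain ⟨i, hi⟩ := hℓ k z (s t) (hs2 t) hk
  refine hi.not_ge ?_
  obtain ⟨w, w', hw, hw', hS, hS'⟩ := ht i
  have him := (hbox (s t) (hs2 t) i).1
  have key : ∀ w : ι → ℕ, (∀ i, t i ≤ w i ∧ w i ≤ t i + 1) →
      |(h (s w) i).re - (h (s t) i).re| ≤ (h (s t) i).im * (Real.exp K - 1) := fun w hw =>
    (UpperHalfPlane.abs_re_sub_le _ _).trans <| by
      have := hK (s w) (s t)
        (hs1 w t (fun i => (hw i).2) fun i => (hw i).1.trans (Nat.le_succ _)) i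
      have := (h (s t) i).im_pos
      gcongr
  have hw1 := abs_le.1 (key w hw)
  have hw2 := abs_le.1 (key w' hw')
  have htw : η * t i ≤ η * w i := by
    have : (t i : ℝ) ≤ w i := by exact_mod_cast (hw i).1
    gcongr
  have htw' : η * w' i ≤ η * t i + η := by
    have : (w' i : ℝ) ≤ t i + 1 := by exact_mod_cast (hw' i).2
    nlinarith
  have hz1 : η * (z i * (2 * r * n : ℕ) - colourShift r n k : ℝ) ≤ η * t i := by
    have : (z i * (2 * r * n : ℕ) : ℝ) ≤ t i + colourShift r n k := by exact_mod_cast (hz i).1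
    gcongr
    linarith
  have hz2 : η * t i ≤ η * (z i * (2 * r * n : ℕ) - colourShift r n k : ℝ) + δ := by
    have : (t i + colourShift r n k : ℝ) ≤ z i * (2 * r * n : ℕ) + (2 * r * n : ℕ) := by
      exact_mod_cast (hz i).2.le
    rw [← hηP, ← mul_add]
    gcongr
    linarith
  have hAim : (Real.exp K + 1) * (h (s t) i).im ≤ A * (h (s t) i).im := by gcongr
  refine le_trans ?_ hAim
  rw [abs_le]
  rw [not_le] at hS'
  constructor <;> nlinarith

/-- For `n ≥ 2` there is no regular map from `(T₃)ⁿ` to `(ℍ²)^{n-1} × Z`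
(ℓ¹ product metrics), whenever `Z` is a connected bounded degree graph of subexponential
growth. -/
theorem no_regular_map_treePower_to_H2Power_times_subexponential
    (n : ℕ) (hn : 2 ≤ n)
    (T Z D P : Type*) [MetricSpace T] [MetricSpace Z] [MetricSpace D] [MetricSpace P]
    (hT : IsCubicTreeMetric T)
    (hZ : IsBddDegGraphMetric Z) (hZgrowth : HasSubexpGrowth Z)
    (eD : D ≃ (Fin n → T))
    (hD : ∀ p q : D, dist p q = ∑ i, dist (eD p i) (eD q i))
    (eP : P ≃ (Fin (n - 1) → UpperHalfPlane) × Z)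
    (hP : ∀ p q : P,
      dist p q = (∑ i, dist ((eP p).1 i) ((eP q).1 i)) + dist (eP p).2 (eP q).2) :
    ¬ ∃ f : D → P, IsRegularMap f := by
  rintro ⟨f, κ, hκ1, hlip, hfib⟩
  classical
  obtain ⟨g, hg, hgrowth⟩ := hZgrowth
  have hTne : Nonempty T := by
    obtain ⟨G, hG, -⟩ := hT
    exact hG.nonempty
  obtain ⟨o⟩ := hTne
  set oD : D := eD.symm fun _ => o
  set h : D → Fin (n - 1) → UpperHalfPlane := fun p => (eP (f p)).1
  set ζ : D → Z := fun p => (eP (f p)).2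
  have hdist : ∀ p q : D, dist (f p) (f q) = ∑ i, dist (h p i) (h q i) + dist (ζ p) (ζ q) :=
    fun p q => hP _ _
  have hdist_h : ∀ (p q : D) i, dist (h p i) (h q i) ≤ dist (f p) (f q) := by
    intro p q i
    rw [hdist]
    have := Finset.single_le_sum (f := fun i => dist (h p i) (h q i))
      (fun _ _ => dist_nonneg) (Finset.mem_univ i)
    exact this.trans (le_add_of_nonneg_right dist_nonneg)
  have hdist_ζ : ∀ p q : D, dist (ζ p) (ζ q) ≤ dist (f p) (f q) := by
    intro p q
    rw [hdist]
    exact le_add_of_nonneg_left (Finset.sum_nonneg fun _ _ => dist_nonneg)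
  have hgpos : ∀ r, 0 ≤ r → 0 < g r := by
    intro r hr
    have := hgrowth (ζ oD) r hr {ζ oD} (by simpa using hr)
    rw [Finset.card_singleton] at this
    exact zero_lt_one.trans_le (by exact_mod_cast this)
  have hsep : ∀ p q : D, dist p q < 1 → p = q := by
    intro p q hpq
    by_contra hne
    obtain ⟨k, hk⟩ := Function.ne_iff.1 (eD.injective.ne hne)
    have h1 := hT.one_le_dist hk
    have := Finset.single_le_sum (f := fun i => dist (eD p i) (eD q i))
      (fun _ _ => dist_nonneg) (Finset.mem_univ k)
    rw [← hD] at this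
    linarith
  have hmult : ∀ (p : D) (F : Finset D),
      (∀ p' ∈ F, ∑ i, dist (h p' i) (h p i) + dist (ζ p') (ζ p) < 1) → F.card ≤ κ := by
    intro p F hF
    obtain ⟨c, hc, hcov⟩ := hfib (f p)
    refine (Finset.card_le_card fun p' hp' => ?_).trans hc
    have hmem : p' ∈ f ⁻¹' ball (f p) 1 := by
      rw [mem_preimage, mem_ball, hdist]
      exact hF p' hp'
    obtain ⟨x, hx, hx'⟩ := mem_iUnion₂.1 (hcov hmem)
    rwa [hsep p' x hx']
  have hsum_le : ∀ (v w : Fin n → T) (r : ℝ), (∀ k, dist (v k) (w k) ≤ r) →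
      dist (eD.symm v) (eD.symm w) ≤ n * r := by
    intro v w r hvw
    rw [hD, Equiv.apply_symm_apply, Equiv.apply_symm_apply]
    simpa using Finset.sum_le_card_nsmul Finset.univ _ r fun k _ => hvw k
  set K : ℝ := κ * (1 + n * 1) with hKdef
  have hK : ∀ v w : Fin n → T, (∀ k, dist (v k) (w k) ≤ 1) →
      ∀ i, dist (h (eD.symm v) i) (h (eD.symm w) i) ≤ K := by
    intro v w hvw i
    refine (hdist_h _ _ i).trans ((hlip _ _).trans ?_)
    have := hsum_le v w 1 hvw
    rw [hKdef]
    gcongr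
  obtain ⟨A, hA⟩ := exists_nat_ge (Real.exp K + 1)
  set q : ℕ := (n - 1) * (2 * A + 3) + 1 with hq
  obtain ⟨r, hr, hlt⟩ := hg.exists_lt_two_pow hgpos
    (C := κ * (2 * q * A + 1) ^ (n - 1)) (by positivity) (a := 2 * q) (by positivity) (n - 1)
    (c := κ * n) (by positivity)
  set R : ℕ := κ * n * (1 + r) with hR
  have hfR : ∀ v : Fin n → T, (∀ k, dist (v k) o ≤ r) → dist (f (eD.symm v)) (f oD) ≤ R := by
    intro v hv
    refine (hlip _ _).trans ?_
    have h1 := hsum_le v (fun _ => o) r hv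
    have h2 : (1 : ℝ) ≤ n := by exact_mod_cast (by omega : 1 ≤ n)
    rw [hR]
    push_cast
    rw [mul_assoc]
    gcongr
    linarith
  have hne : Nonempty (Fin (n - 1)) := ⟨⟨0, by omega⟩⟩
  obtain ⟨i₀, hi₀⟩ := Finite.exists_min fun i => (h oD i).im
  obtain ⟨i₁, hi₁⟩ := Finite.exists_max fun i => (h oD i).im
  obtain ⟨L, γ, hL, hγ0, hγ1, hγL⟩ := hT.exists_rays o r
  obtain ⟨k, τ, hkτ⟩ := exists_cone_meeting_all_rays hγ0 hγ1 (ι := Fin (n - 1)) hr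
    (by rw [Fintype.card_fin]; omega) (fun v => h (eD.symm v)) hK hA
    (fun i => (h oD i).re) (B := (h oD i₁).im * Real.exp R)
    (δ := (h oD i₀).im / Real.exp R)
    (by have := (h oD i₀).im_pos
        positivity) <| by
    intro v hv i
    have hd := (hdist_h _ _ i).trans (hfR v hv)
    constructor
    · rw [div_le_iff₀ (Real.exp_pos _)]
      refine (hi₀ i).trans ?_
      have h1 := UpperHalfPlane.im_div_exp_dist_le (h oD i) (h (eD.symm v) i)
      rw [div_le_iff₀ (Real.exp_pos _), dist_comm] at h1
      have := (h (eD.symm v) i).im_pos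
      exact h1.trans (by gcongr)
    · have h1 := UpperHalfPlane.abs_re_sub_le (h (eD.symm v) i) (h oD i)
      have h2 := (h oD i).im_pos
      calc |(h (eD.symm v) i).re - (h oD i).re|
          ≤ (h oD i).im * (Real.exp (dist (h (eD.symm v) i) (h oD i)) - 1) := h1
        _ < (h oD i).im * Real.exp (dist (h (eD.symm v) i) (h oD i)) := by
          gcongr
          exact sub_one_lt _
        _ ≤ (h oD i₁).im * Real.exp R := by
          gcongr
          exact hi₁ i
  choose v hvbox hvk hvA using hkτ
  have hinj : Set.InjOn (fun x => eD.symm (v x)) L := by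
    intro x hx y hy hxy
    have := congrFun (eD.symm.injective hxy) k
    rwa [hvk, hvk, hγL x hx, hγL y hy] at this
  have hcard := card_le_of_mem_cones hgrowth (A := A) (q := q) (κ := κ) (R := R)
    (by rw [Fintype.card_fin]; omega) h ζ hmult oD τ (L.image fun x => eD.symm (v x))
    (by
      intro p hp
      obtain ⟨x, -, rfl⟩ := Finset.mem_image.1 hp
      exact ⟨fun i => (hdist_h _ _ i).trans (hfR _ (hvbox x)),
        (hdist_ζ _ _).trans (hfR _ (hvbox x))⟩)
    (by
      intro p hp i
      obtain ⟨x, -, rfl⟩ := Finset.mem_image.1 hp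
      exact hvA x i)
  rw [Finset.card_image_of_injOn hinj, Fintype.card_fin, mul_pow, ← mul_assoc] at hcard
  have hL' : (2 : ℝ) ^ r ≤ L.card := by exact_mod_cast hL
  exact absurd (hL'.trans hcard) (not_le.2 hlt)
end
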